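/- arXiv:2505.01087 — 2 statements merged into one kernel-verified Lean document; each statement's English description precedes it below -/
import Mathlib

section
/- Fix integers m₀ ≥ 1 and k ≥ 0. Then as n → ∞, 𝒬_{n,k}(m₀) = (c_k/((k+1)m₀−1)!)·n^{(k+1)m₀−1} + O(n^{(k+1)m₀−2}); that is, there is a constant C > 0 such that |𝒬_{n,k}(m₀) − (c_k/((k+1)m₀−1)!)·n^{(k+1)m₀−1}| ≤ C·n^{(k+1)m₀−2} for all n ≥ 1. -/
open Polynomial

/-- The ring `ℚ[m][t]`: polynomials in `t` with coefficients in `ℚ[m]`. -/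
abbrev Qmt : Type := Polynomial (Polynomial ℚ)

/-- The element `m` of `ℚ[m][t]`. -/
noncomputable def mPoly : Qmt := Polynomial.C Polynomial.X

/-- `f^{[d]}`: substitute `t ↦ t^d`, leaving `m` unchanged. -/
noncomputable def tPow (d : ℕ) (f : Qmt) : Qmt := f.comp (Polynomial.X ^ d)

/-- `f^{[μ]} = f^{[μ₁]} ⋯ f^{[μ_ℓ]}` for a multiset `μ` of positive integers. -/
noncomputable def tPowMul (μ : Multiset ℕ) (f : Qmt) : Qmt := (μ.map (fun d => tPow d f)).prod

/-- `z_μ = ∏ i, i ^ (mult of i) * (mult of i)!`. -/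
def zPart (μ : Multiset ℕ) : ℕ := ∏ i ∈ μ.toFinset, i ^ μ.count i * (μ.count i).factorial

/-- The plethysm `h_r ∘ f = Σ_{μ ⊢ r} z_μ⁻¹ f^{[μ]}`. -/
noncomputable def plethH (r : ℕ) (f : Qmt) : Qmt :=
  ∑ μ : Nat.Partition r, Polynomial.C (Polynomial.C ((zPart μ.parts : ℚ)⁻¹)) * tPowMul μ.parts f

/-- The polynomials `𝒬ₙ⁺ ∈ ℚ[m][t]`: `𝒬₁⁺ = m` and, for `n ≥ 2`,
`𝒬ₙ⁺ = Σ_{λ ⊢ n} (Σ_{i=1}^{ℓ(λ)-2} t^i) ∏_j (h_{r_j} ∘ 𝒬⁺_{n_j})` where `n_j` are the distinct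
parts of `λ` with multiplicities `r_j`.  (The recursion is well-founded: the term of `λ = (n)`
has coefficient `Σ_{i=1}^{1-2} t^i = 0`, so the guard `p < n` does not change any value.) -/
noncomputable def Qplus : ℕ → Qmt := fun n =>
  Nat.strongRecOn n fun n ih =>
    if n = 1 then mPoly
    else
      ∑ lam : Nat.Partition n,
        (∑ i ∈ Finset.Icc 1 (Multiset.card lam.parts - 2), (Polynomial.X : Qmt) ^ i) *
          ∏ p ∈ lam.parts.toFinset,
            plethH (lam.parts.count p) (if h : p < n then ih p h else 0)

/-- The polynomials `𝒬ₙ ∈ ℚ[m][t]`: `𝒬₁ = m` and, for `n ≥ 2`,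
`𝒬ₙ = Σ_{λ ⊢ n} ∏_j (h_{r_j} ∘ 𝒬⁺_{n_j})`. -/
noncomputable def Qfull (n : ℕ) : Qmt :=
  if n = 1 then mPoly
  else ∑ lam : Nat.Partition n, ∏ p ∈ lam.parts.toFinset, plethH (lam.parts.count p) (Qplus p)

/-- `𝒬_{n,k}(m)`: the coefficient of `t^k` in `𝒬ₙ`, a polynomial in `m`. -/
noncomputable def Qnk (n k : ℕ) : Polynomial ℚ := (Qfull n).coeff k

/-- The right-hand side `𝒬ₙ − (t/2)(Σ_{h=2}^{n-2} 𝒬_h 𝒬_{n-h} − 𝒬_{n/2}^{[2]})` of the relation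
defining `𝒫ₙ`, where `𝒬_{n/2} = 0` when `n` is odd. -/
noncomputable def Prhs (n : ℕ) : Qmt :=
  Qfull n -
    Polynomial.C (Polynomial.C ((2 : ℚ)⁻¹)) * Polynomial.X *
      ((∑ h ∈ Finset.Icc 2 (n - 2), Qfull h * Qfull (n - h)) -
        (if 2 ∣ n then tPow 2 (Qfull (n / 2)) else 0))

/-- `c_k = (k+1)^{k-1}/k!`. -/
noncomputable def ck (k : ℕ) : ℚ := ((k : ℚ) + 1) ^ ((k : ℤ) - 1) / (k.factorial : ℚ)

/-- `d_k = (k+1)^{k-2}/k!`. -/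
noncomputable def dk (k : ℕ) : ℚ := ((k : ℚ) + 1) ^ ((k : ℤ) - 2) / (k.factorial : ℚ)

section PartitionSums

variable {A R : Type*} [CommRing A] [CommRing R] [Algebra A R]

/-- The sum over the partitions `λ` of `n` of `∏ w p (multiplicity of p in λ)`, over the parts `p`
of `λ`. -/
noncomputable def partitionSum (w : ℕ → ℕ → R) (n : ℕ) : R :=
  ∑ lam : Nat.Partition n, ∏ p ∈ lam.parts.toFinset, w p (lam.parts.count p)

/-- The series `∑ r, w p r * X ^ (p * r)`. -/
noncomputable def partSeries (w : ℕ → ℕ → R) (p : ℕ) : PowerSeries R :=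
  PowerSeries.mk fun i => if p ∣ i then w p (i / p) else 0

theorem coeff_prod_partSeries {w : ℕ → ℕ → R} (hw : ∀ p, w p 0 = 1) {n : ℕ} {S : Finset ℕ}
    (hS : Finset.Icc 1 n ⊆ S) (h0 : 0 ∉ S) :
    PowerSeries.coeff n (∏ p ∈ S, partSeries w p) = partitionSum w n := by
  rw [PowerSeries.coeff_prod, partitionSum]
  refine (Finset.sum_of_injOn Nat.Partition.toFinsuppAntidiag
    (Nat.Partition.toFinsuppAntidiag_injective n).injOn ?_ ?_ ?_).symm
  · intro p _
    exact Finset.mem_of_subset (Finset.finsuppAntidiag_mono hS _)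
      p.toFinsuppAntidiag_mem_finsuppAntidiag
  · intro g hg hg'
    by_contra hne
    apply hg'
    obtain ⟨h1, h2⟩ := Finset.mem_finsuppAntidiag.mp hg
    have hdvd : ∀ x, x ∣ g x := by
      intro x
      by_cases hx : x ∈ S
      · have := fun h => hne (Finset.prod_eq_zero hx h)
        by_contra hnd
        simp [partSeries, hnd] at this
      · have : g x = 0 := by
          contrapose! hx
          exact h2 (by simpa using hx)
        simp [this]
    have hgne0 (i : ℕ) : g i ≠ 0 ↔ i ≠ 0 ∧ i ≤ g i := by
      refine ⟨fun h ↦ ⟨?_, Nat.le_of_dvd (Nat.pos_of_ne_zero h) (hdvd _)⟩, by grind⟩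
      rintro rfl
      exact h0 (h2 (by simpa using h))
    rw [Finset.coe_univ, Set.image_univ, Set.mem_range]
    refine ⟨Nat.Partition.mk
      (Finsupp.mk g.support (fun i ↦ g i / i) ?_).toMultiset ?_ ?_, ?_⟩
    · simpa using hgne0
    · suffices ∀ i, g i ≠ 0 → i ≠ 0 by simpa [Nat.pos_iff_ne_zero]
      exact fun i h ↦ ((hgne0 i).mp h).1
    · refine Eq.trans ?_ h1
      suffices ∑ x ∈ g.support, g x / x * x = ∑ x ∈ S, g x by simpa [Finsupp.sum]
      apply Finset.sum_subset_zero_on_sdiff h2 (by simp)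
      exact fun x _ ↦ Nat.div_mul_cancel <| hdvd x
    · ext x
      simpa [Nat.Partition.toFinsuppAntidiag] using Nat.div_mul_cancel <| hdvd x
  · intro p _
    apply Finset.prod_subset_one_on_sdiff
    · intro i hi
      rw [Multiset.mem_toFinset] at hi
      exact hS (Finset.mem_Icc.2 ⟨p.parts_pos hi, Nat.Partition.le_of_mem_parts hi⟩)
    · intro x hx
      rw [Finset.mem_sdiff, Multiset.mem_toFinset] at hx
      simp [Nat.Partition.toFinsuppAntidiag, hx.2, partSeries, hw]
    · intro i hi
      rw [Multiset.mem_toFinset] at hi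
      have hi0 : 0 < i := p.parts_pos hi
      simp [Nat.Partition.toFinsuppAntidiag, partSeries, hi0]

/-- The coefficientwise extension of a derivation, plus `e` times the Euler derivation `X d/dX`. -/
noncomputable def seriesDer (D : Derivation A R R) (e : ℕ) (f : PowerSeries R) : PowerSeries R :=
  PowerSeries.mk fun n => D (PowerSeries.coeff n f) + (n * e : ℕ) * PowerSeries.coeff n f

theorem seriesDer_mul (D : Derivation A R R) (e : ℕ) (f g : PowerSeries R) :
    seriesDer D e (f * g) = seriesDer D e f * g + f * seriesDer D e g := by
  ext n
  simp only [seriesDer, PowerSeries.coeff_mk, map_add, PowerSeries.coeff_mul, map_sum,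
    Finset.mul_sum, ← Finset.sum_add_distrib]
  refine Finset.sum_congr rfl fun x hx => ?_
  rw [← Finset.HasAntidiagonal.mem_antidiagonal.1 hx, Derivation.leibniz]
  push_cast
  simp only [smul_eq_mul]
  ring

theorem seriesDer_one (D : Derivation A R R) (e : ℕ) : seriesDer D e (1 : PowerSeries R) = 0 := by
  ext n
  rcases Nat.eq_zero_or_pos n with rfl | hn
  · simp [seriesDer]
  · simp [seriesDer, PowerSeries.coeff_one, hn.ne']

theorem seriesDer_prod (D : Derivation A R R) (e : ℕ) (S : Finset ℕ) (F U : ℕ → PowerSeries R)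
    (h : ∀ p ∈ S, seriesDer D e (F p) = U p * F p) :
    seriesDer D e (∏ p ∈ S, F p) = (∑ p ∈ S, U p) * ∏ p ∈ S, F p := by
  induction S using Finset.induction_on with
  | empty => simp [seriesDer_one]
  | insert a S ha ih =>
    rw [Finset.prod_insert ha, Finset.sum_insert ha, seriesDer_mul,
      ih fun p hp => h p (Finset.mem_insert_of_mem hp), h a (Finset.mem_insert_self _ _)]
    ring

theorem sum_antidiagonal_dvd {M : Type*} [AddCommMonoid M] {p n : ℕ} (hp : 0 < p)
    (f : ℕ → ℕ → M) (hf : ∀ i j, i + j = n → ¬ (p ∣ i ∧ p ∣ j) → f i j = 0) (r : ℕ)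
    (hn : n = p * r) :
    ∑ x ∈ Finset.HasAntidiagonal.antidiagonal n, f x.1 x.2 =
      ∑ x ∈ Finset.HasAntidiagonal.antidiagonal r, f (p * x.1) (p * x.2) := by
  subst hn
  refine (Finset.sum_of_injOn (fun x : ℕ × ℕ => (p * x.1, p * x.2)) ?_ ?_ ?_ ?_).symm
  · rintro ⟨a, b⟩ _ ⟨c, d⟩ _ h
    simpa [hp.ne'] using h
  · rintro ⟨a, b⟩ h
    simp only [Finset.mem_coe,
      Finset.HasAntidiagonal.mem_antidiagonal] at h ⊢
    rw [← h, mul_add]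
  · rintro ⟨a, b⟩ h h'
    rw [Finset.HasAntidiagonal.mem_antidiagonal] at h
    refine hf _ _ h fun ⟨⟨c, hc⟩, ⟨d, hd⟩⟩ => h' ?_
    simp only at hc hd h
    subst hc hd
    refine ⟨(c, d), ?_, rfl⟩
    simp only [Finset.mem_coe, Finset.HasAntidiagonal.mem_antidiagonal]
    exact Nat.eq_of_mul_eq_mul_left hp (by rw [mul_add, h])
  · simp

theorem partitionSum_der (D : Derivation A R R) (e : ℕ) {w u : ℕ → ℕ → R} (hw : ∀ p, w p 0 = 1)
    (h : ∀ p r, 0 < p → D (w p r) + (p * r * e : ℕ) * w p r =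
      ∑ x ∈ Finset.HasAntidiagonal.antidiagonal r, u p x.1 * w p x.2) (hu : ∀ p, u p 0 = 0) (n : ℕ) :
    D (partitionSum w n) + (n * e : ℕ) * partitionSum w n =
      ∑ x ∈ Finset.HasAntidiagonal.antidiagonal n,
        (∑ p ∈ x.1.divisors, u p (x.1 / p)) * partitionSum w x.2 := by
  have key := seriesDer_prod D e (Finset.Icc 1 n) (partSeries w) (partSeries u) (by
    intro p hp
    have hp0 : 0 < p := (Finset.mem_Icc.1 hp).1
    ext i
    rw [PowerSeries.coeff_mul]
    by_cases hpi : p ∣ i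
    · obtain ⟨r, rfl⟩ := hpi
      rw [sum_antidiagonal_dvd hp0 (fun a b => PowerSeries.coeff a (partSeries u p) *
        PowerSeries.coeff b (partSeries w p)) ?_ r rfl]
      · simpa [seriesDer, partSeries, hp0] using h p r hp0
      · intro a b _ hab
        rw [not_and_or] at hab
        rcases hab with hab | hab <;> simp [partSeries, hab]
    · rw [Finset.sum_eq_zero]
      · simp [seriesDer, partSeries, hpi]
      · intro x hx
        rw [Finset.HasAntidiagonal.mem_antidiagonal] at hx
        by_cases h1 : p ∣ x.1
        · have h2 : ¬ p ∣ x.2 := fun h2 => hpi (hx ▸ dvd_add h1 h2)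
          simp [partSeries, h2]
        · simp [partSeries, h1])
  have key' := congrArg (PowerSeries.coeff n) key
  rw [PowerSeries.coeff_mul, seriesDer, PowerSeries.coeff_mk,
    coeff_prod_partSeries hw (Finset.Subset.refl _) (by simp)] at key'
  rw [key']
  refine Finset.sum_congr rfl fun x hx => ?_
  rw [Finset.HasAntidiagonal.mem_antidiagonal] at hx
  rw [coeff_prod_partSeries hw (Finset.Icc_subset_Icc_right (by omega)) (by simp), map_sum]
  congr 1
  rcases Nat.eq_zero_or_pos x.1 with h0 | h0
  · simp [partSeries, h0, hu]
  · simp only [partSeries, PowerSeries.coeff_mk]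
    rw [← Finset.sum_filter]
    refine Finset.sum_congr ?_ fun _ _ => rfl
    ext p
    simp only [Finset.mem_filter, Finset.mem_Icc, Nat.mem_divisors]
    constructor
    · rintro ⟨_, h⟩
      exact ⟨h, h0.ne'⟩
    · rintro ⟨h, _⟩
      exact ⟨⟨Nat.pos_of_dvd_of_pos h h0, (Nat.le_of_dvd h0 h).trans (by omega)⟩, h⟩

theorem partitionSum_zero (w : ℕ → ℕ → R) : partitionSum w 0 = 1 := by
  simp [partitionSum]

end PartitionSums

/-- The Euler derivation `t d/dt` of `ℚ[m][t]`. -/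
noncomputable def eulerDer : Derivation (Polynomial ℚ) Qmt Qmt :=
  (Polynomial.X : Qmt) • Polynomial.derivative'

theorem eulerDer_apply (f : Qmt) : eulerDer f = Polynomial.X * Polynomial.derivative f := rfl

theorem coeff_eulerDer (f : Qmt) (k : ℕ) : (eulerDer f).coeff k = k * f.coeff k := by
  rw [eulerDer_apply]
  cases k with
  | zero => simp
  | succ k => rw [Polynomial.coeff_X_mul, Polynomial.coeff_derivative]; push_cast; ring

theorem eulerDer_C (c : Polynomial ℚ) : eulerDer (Polynomial.C c) = 0 := by
  simp

theorem tPow_add (d : ℕ) (f g : Qmt) : tPow d (f + g) = tPow d f + tPow d g := by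
  simp [tPow]

theorem tPow_natCast_mul (d n : ℕ) (f : Qmt) : tPow d (n * f) = n * tPow d f := by
  simp [tPow]

theorem coeff_tPow {d : ℕ} (hd : 0 < d) (f : Qmt) (k : ℕ) :
    (tPow d f).coeff k = if d ∣ k then f.coeff (k / d) else 0 := by
  rw [tPow, ← Polynomial.expand_eq_comp_X_pow, Polynomial.coeff_expand hd]

theorem eulerDer_tPow (d : ℕ) (f : Qmt) : eulerDer (tPow d f) = d * tPow d (eulerDer f) := by
  cases d with
  | zero => simp [eulerDer_apply, tPow]
  | succ d =>
    simp [eulerDer_apply, tPow, Polynomial.derivative_comp]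
    ring

/-- The contribution of `j` parts equal to `d` to `h_r ∘ f`. -/
noncomputable def plethWeight (f : Qmt) (d j : ℕ) : Qmt :=
  Polynomial.C (Polynomial.C (((d ^ j * j.factorial : ℕ) : ℚ)⁻¹)) * tPow d f ^ j

theorem plethH_eq_partitionSum (r : ℕ) (f : Qmt) :
    plethH r f = partitionSum (plethWeight f) r := by
  refine Finset.sum_congr rfl fun μ _ => ?_
  simp only [plethWeight, Finset.prod_mul_distrib, tPowMul, zPart, Finset.prod_multiset_map_count]
  congr 1
  rw [← map_prod, ← map_prod, Finset.prod_inv_distrib, ← Finset.prod_mul_distrib, Nat.cast_prod]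

theorem plethH_der (e r : ℕ) (f : Qmt) :
    eulerDer (plethH r f) + (r * e : ℕ) * plethH r f =
      ∑ x ∈ Finset.HasAntidiagonal.antidiagonal r,
        (if x.1 = 0 then 0 else tPow x.1 (eulerDer f + e * f)) * plethH x.2 f := by
  simp only [plethH_eq_partitionSum]
  rw [partitionSum_der eulerDer e (u := fun d i => if i = 1 then tPow d (eulerDer f + e * f) else 0)
    (by simp [plethWeight]) ?_ (by simp)]
  · refine Finset.sum_congr rfl fun x _ => ?_
    congr 1
    split_ifs with h0
    · simp [h0]
    · rw [Finset.sum_eq_single x.1]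
      · simp [Nat.div_self (Nat.pos_of_ne_zero h0)]
      · intro d hd hne
        rw [if_neg]
        intro h1
        have := Nat.div_mul_cancel (Nat.dvd_of_mem_divisors hd)
        rw [h1, one_mul] at this
        exact hne this
      · simp [h0]
  · intro d j hd
    cases j with
    | zero => simp [plethWeight]
    | succ j =>
      rw [Finset.sum_eq_single (1, j)]
      · simp only [if_true, plethWeight, Derivation.leibniz, eulerDer_C, Derivation.leibniz_pow,
          eulerDer_tPow, tPow_add, tPow_natCast_mul, smul_eq_mul, nsmul_eq_mul]
        have hq : (Polynomial.C (Polynomial.C (((d ^ j * j.factorial : ℕ) : ℚ)⁻¹)) : Qmt) =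
            Polynomial.C (Polynomial.C (((d ^ (j + 1) * (j + 1).factorial : ℕ) : ℚ)⁻¹)) *
              (d * (j + 1) : ℕ) := by
          rw [← map_natCast (Polynomial.C : Polynomial ℚ →+* Qmt),
            ← map_natCast (Polynomial.C : ℚ →+* Polynomial ℚ), ← map_mul, ← map_mul]
          congr 2
          have : (d : ℚ) ≠ 0 := by exact_mod_cast hd.ne'
          have : (j.factorial : ℚ) ≠ 0 := by exact_mod_cast j.factorial_ne_zero
          push_cast [Nat.factorial_succ]
          field_simp
          ring
        rw [hq]
        push_cast
        ring
      · rintro ⟨a, b⟩ hab hne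
        rw [Finset.HasAntidiagonal.mem_antidiagonal] at hab
        rw [if_neg, zero_mul]
        rintro rfl
        apply hne
        ext <;> simp at hab ⊢
        omega
      · intro h
        exact absurd (Finset.HasAntidiagonal.mem_antidiagonal.2 (by simp; ring)) h

theorem plethH_zero (f : Qmt) : plethH 0 f = 1 := by
  rw [plethH_eq_partitionSum, partitionSum_zero]

theorem plethH_one (f : Qmt) : plethH 1 f = f := by
  simp [plethH, zPart, tPowMul, tPow]

theorem plethH_X_mul (r : ℕ) (f : Qmt) :
    plethH r (Polynomial.X * f) = Polynomial.X ^ r * plethH r f := by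
  rw [plethH, plethH, Finset.mul_sum]
  refine Finset.sum_congr rfl fun μ _ => ?_
  have : tPowMul μ.parts (Polynomial.X * f) = Polynomial.X ^ r * tPowMul μ.parts f := by
    have hX : ∀ s : Multiset ℕ,
        tPowMul s (Polynomial.X * f) = Polynomial.X ^ s.sum * tPowMul s f := by
      intro s
      induction s using Multiset.induction_on with
      | empty => simp [tPowMul]
      | cons a s ih =>
        simp only [tPowMul, Multiset.map_cons, Multiset.prod_cons, Multiset.sum_cons] at ih ⊢
        rw [ih]
        simp [tPow]
        ring
    rw [hX, μ.parts_sum]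
  rw [this]
  ring

/-- The degree `n` part of the plethystic exponential of `∑ p, a p`. -/
noncomputable def plethExp (a : ℕ → Qmt) (n : ℕ) : Qmt :=
  partitionSum (fun p r => plethH r (a p)) n

theorem plethExp_zero (a : ℕ → Qmt) : plethExp a 0 = 1 := partitionSum_zero _

theorem plethExp_one (a : ℕ → Qmt) : plethExp a 1 = a 1 := by
  simp [plethExp, partitionSum, plethH_one]

theorem plethExp_der (a : ℕ → Qmt) (e n : ℕ) :
    eulerDer (plethExp a n) + (n * e : ℕ) * plethExp a n =
      ∑ x ∈ Finset.HasAntidiagonal.antidiagonal n,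
        (∑ p ∈ x.1.divisors, tPow (x.1 / p) (eulerDer (a p) + (p * e : ℕ) * a p)) *
          plethExp a x.2 := by
  rw [plethExp, partitionSum_der eulerDer e
    (u := fun p d => if d = 0 then 0 else tPow d (eulerDer (a p) + (p * e : ℕ) * a p))
    (fun p => plethH_zero _) ?_ (by simp)]
  · refine Finset.sum_congr rfl fun x _ => ?_
    congr 1
    refine Finset.sum_congr rfl fun p hp => ?_
    rw [if_neg]
    exact (Nat.div_pos (Nat.divisor_le hp) (Nat.pos_of_mem_divisors hp)).ne'
  · intro p r _
    rw [← plethH_der, mul_right_comm, mul_comm (p * e) r]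

theorem Qplus_one : Qplus 1 = mPoly := by
  rw [Qplus, Nat.strongRecOn_eq]
  simp

theorem Qplus_eq {n : ℕ} (hn : n ≠ 1) :
    Qplus n = ∑ lam : Nat.Partition n,
      (∑ i ∈ Finset.Icc 1 (Multiset.card lam.parts - 2), (Polynomial.X : Qmt) ^ i) *
        ∏ p ∈ lam.parts.toFinset, plethH (lam.parts.count p) (Qplus p) := by
  conv_lhs => rw [Qplus, Nat.strongRecOn_eq]
  rw [if_neg hn]
  refine Finset.sum_congr rfl fun lam _ => ?_
  by_cases hc : Multiset.card lam.parts ≤ 2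
  · simp [Nat.sub_eq_zero_of_le hc]
  · congr 1
    refine Finset.prod_congr rfl fun p hp => ?_
    rw [Multiset.mem_toFinset] at hp
    have hlt : p < n := by
      refine lt_of_le_of_ne (Nat.Partition.le_of_mem_parts hp) ?_
      rintro rfl
      apply hc
      obtain ⟨s, hs⟩ := Multiset.exists_cons_of_mem hp
      have hsum := lam.parts_sum
      rw [hs, Multiset.sum_cons] at hsum
      have hs0 : s.sum = 0 := by omega
      have : s = 0 := by
        refine Multiset.eq_zero_of_forall_notMem fun x hx => ?_
        have h1 := Multiset.le_sum_of_mem hx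
        have h2 : 0 < x := lam.parts_pos (by rw [hs]; exact Multiset.mem_cons_of_mem hx)
        omega
      simp [hs, this]
    rw [dif_pos hlt]
    rfl

theorem Qplus_zero : Qplus 0 = 0 := by
  rw [Qplus_eq (by simp)]
  simp

theorem Qfull_eq_plethExp (n : ℕ) : Qfull n = plethExp Qplus n := by
  by_cases hn : n = 1
  · subst hn
    rw [plethExp_one, Qplus_one]
    simp [Qfull]
  · rw [Qfull, if_neg hn]
    rfl

theorem plethExp_X_mul (a : ℕ → Qmt) (n : ℕ) :
    plethExp (fun p => Polynomial.X * a p) n = ∑ lam : Nat.Partition n,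
      Polynomial.X ^ (Multiset.card lam.parts) *
        ∏ p ∈ lam.parts.toFinset, plethH (lam.parts.count p) (a p) := by
  rw [plethExp, partitionSum]
  refine Finset.sum_congr rfl fun lam _ => ?_
  simp only [plethH_X_mul, Finset.prod_mul_distrib, Finset.prod_pow_eq_pow_sum,
    Multiset.toFinset_sum_count_eq]

theorem partition_card_le_one {n : ℕ} (hn : 2 ≤ n) (lam : Nat.Partition n)
    (h : Multiset.card lam.parts ≤ 1) : lam = Nat.Partition.indiscrete n := by
  ext1
  rw [Nat.Partition.indiscrete_parts (by omega)]
  have hsum := lam.parts_sum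
  interval_cases hc : Multiset.card lam.parts
  · rw [Multiset.card_eq_zero] at hc
    rw [hc] at hsum
    simp at hsum
    omega
  · obtain ⟨x, hx⟩ := Multiset.card_eq_one.1 hc
    rw [hx] at hsum ⊢
    simpa using hsum

theorem plethExp_X_mul_Qplus {n : ℕ} (hn : 2 ≤ n) :
    plethExp (fun p => Polynomial.X * Qplus p) n = Polynomial.X ^ 2 * plethExp Qplus n := by
  have hterm : ∀ lam : Nat.Partition n,
      Polynomial.X * (Polynomial.X - 1) *
        ((∑ i ∈ Finset.Icc 1 (Multiset.card lam.parts - 2), (Polynomial.X : Qmt) ^ i) *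
          ∏ p ∈ lam.parts.toFinset, plethH (lam.parts.count p) (Qplus p)) =
      Polynomial.X ^ (Multiset.card lam.parts) *
        (∏ p ∈ lam.parts.toFinset, plethH (lam.parts.count p) (Qplus p)) -
      Polynomial.X ^ 2 * (∏ p ∈ lam.parts.toFinset, plethH (lam.parts.count p) (Qplus p)) +
      (if lam = Nat.Partition.indiscrete n then
        Polynomial.X * (Polynomial.X - 1) * Qplus n else 0) := by
    intro lam
    split_ifs with h
    · subst h
      rw [Nat.Partition.indiscrete_parts (by omega)]
      simp [plethH_one]
      ring
    · have hc : 2 ≤ Multiset.card lam.parts := by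
        by_contra hlt
        exact h (partition_card_le_one hn lam (by omega))
      obtain ⟨c, hc⟩ := Nat.exists_eq_add_of_le hc
      have hgeom : ∀ c : ℕ, (Polynomial.X - 1) *
          ∑ i ∈ Finset.Icc 1 c, (Polynomial.X : Qmt) ^ i =
            Polynomial.X ^ (c + 1) - Polynomial.X := by
        intro c
        induction c with
        | zero => simp
        | succ c ih =>
          rw [Finset.sum_Icc_succ_top (by omega), mul_add, ih]
          ring
      rw [hc, Nat.add_sub_cancel_left, add_zero, ← mul_assoc, mul_assoc Polynomial.X, hgeom]
      ring
  have hsum := Fintype.sum_congr _ _ hterm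
  rw [← Finset.mul_sum, ← Qplus_eq (by omega), Finset.sum_add_distrib, Finset.sum_sub_distrib,
    ← plethExp_X_mul, ← Finset.mul_sum, Finset.sum_ite_eq' Finset.univ,
    if_pos (Finset.mem_univ _)] at hsum
  have h2 : plethExp Qplus n = ∑ lam : Nat.Partition n,
      ∏ p ∈ lam.parts.toFinset, plethH (lam.parts.count p) (Qplus p) := rfl
  rw [h2]
  linear_combination -hsum


/-- The generating series `∑ n, [t ^ k] (a n) * X ^ n`, evaluated at `m = m₀`. -/
noncomputable def coeffSeries (m₀ : ℕ) (a : ℕ → Qmt) (k : ℕ) : PowerSeries ℚ :=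
  PowerSeries.mk fun n => ((a n).coeff k).eval (m₀ : ℚ)

/-- The substitution `X ↦ X ^ d` in a power series. -/
noncomputable def dilate (d : ℕ) (A : PowerSeries ℚ) : PowerSeries ℚ :=
  PowerSeries.mk fun n => if d ∣ n then PowerSeries.coeff (n / d) A else 0

/-- The `t ^ i`-coefficient of the logarithmic derivative of the plethystic exponential of `a`. -/
noncomputable def logDerSeries (m₀ : ℕ) (a : ℕ → Qmt) (i : ℕ) : PowerSeries ℚ :=
  ∑ d ∈ i.divisors, ((i / d : ℕ) : ℚ) • dilate d (coeffSeries m₀ a (i / d))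

theorem sum_divisors_swap (g : ℕ → ℕ → ℚ) (hg : ∀ l, g 0 l = 0) (hg' : ∀ p, g p 0 = 0) (i j : ℕ) :
    ∑ p ∈ i.divisors, (if i / p ∣ j then g p (j / (i / p)) else 0) =
      ∑ d ∈ j.divisors, (if d ∣ i then g (i / d) (j / d) else 0) := by
  rcases Nat.eq_zero_or_pos i with rfl | hi
  · simp [hg]
  rcases Nat.eq_zero_or_pos j with rfl | hj
  · simp [hg']
  have h1 : ∑ p ∈ i.divisors, (if i / p ∣ j then g p (j / (i / p)) else 0) =
      ∑ p ∈ i.divisors, (fun d => if d ∣ j then g (i / d) (j / d) else 0) (i / p) := by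
    refine Finset.sum_congr rfl fun p hp => ?_
    simp only [Nat.div_div_self (Nat.dvd_of_mem_divisors hp) hi.ne']
  rw [h1, Nat.sum_div_divisors i (fun d => if d ∣ j then g (i / d) (j / d) else 0),
    ← Finset.sum_filter, ← Finset.sum_filter]
  refine Finset.sum_congr ?_ fun _ _ => rfl
  ext d
  simp only [Finset.mem_filter, Nat.mem_divisors]
  grind

theorem coeffSeries_plethExp_rec (m₀ : ℕ) (a : ℕ → Qmt) (ha : a 0 = 0) (k : ℕ) :
    (k : ℚ) • coeffSeries m₀ (plethExp a) k =
      ∑ y ∈ Finset.HasAntidiagonal.antidiagonal k,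
        logDerSeries m₀ a y.1 * coeffSeries m₀ (plethExp a) y.2 := by
  ext n
  have h := congrArg (fun f : Qmt => (f.coeff k).eval (m₀ : ℚ)) (plethExp_der a 0 n)
  simp only [mul_zero, Nat.cast_zero, zero_mul, add_zero, coeff_eulerDer, Polynomial.eval_mul,
    Polynomial.eval_natCast, Polynomial.finsetSum_coeff, Polynomial.eval_finsetSum,
    Polynomial.coeff_mul] at h
  simp only [map_smul, smul_eq_mul, coeffSeries, PowerSeries.coeff_mk, h, map_sum,
    PowerSeries.coeff_mul]
  rw [Finset.sum_comm]
  refine Finset.sum_congr rfl fun y _ => Finset.sum_congr rfl fun x _ => ?_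
  congr 1
  have hs := sum_divisors_swap (fun p l => (l : ℚ) * ((a p).coeff l).eval (m₀ : ℚ))
    (by simp [ha]) (by simp) x.1 y.1
  simp only [logDerSeries, dilate, coeffSeries, map_sum, map_smul, PowerSeries.coeff_mk,
    smul_eq_mul, mul_ite, mul_zero]
  rw [← hs]
  refine Finset.sum_congr rfl fun p hp => ?_
  rw [coeff_tPow (Nat.div_pos (Nat.divisor_le hp) (Nat.pos_of_mem_divisors hp))]
  split_ifs <;> simp [coeff_eulerDer]

theorem coeff_zero_Qplus (p : ℕ) (hp : p ≠ 1) : (Qplus p).coeff 0 = 0 := by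
  rw [Qplus_eq hp, Polynomial.finsetSum_coeff]
  refine Finset.sum_eq_zero fun lam _ => ?_
  rw [Polynomial.mul_coeff_zero, Polynomial.finsetSum_coeff, Finset.sum_eq_zero, zero_mul]
  intro i hi
  have : i ≠ 0 := by have := (Finset.mem_Icc.1 hi).1; omega
  simp [Polynomial.coeff_X_pow, this.symm]

theorem invOneSubPow_of_rec (s : ℕ) (e : ℕ → ℚ) (h0 : e 0 = 1)
    (h : ∀ n, (n + 1) * e (n + 1) = (s + 1) * ∑ i ∈ Finset.range (n + 1), e i) (n : ℕ) :
    e n = Nat.choose (s + n) s := by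
  have hc : ∀ n : ℕ, ((n : ℚ) + 1) * Nat.choose (s + (n + 1)) s =
      (s + 1 + n) * Nat.choose (s + n) s := by
    intro n
    have := Nat.choose_mul_succ_eq (s + n) s
    rw [show s + n + 1 - s = n + 1 by omega] at this
    have h2 : (Nat.choose (s + n) s : ℚ) * ((s + n + 1 : ℕ) : ℚ) =
      (Nat.choose (s + (n + 1)) s : ℚ) * ((n + 1 : ℕ) : ℚ) := by exact_mod_cast this
    push_cast at h2
    linear_combination -h2
  have key : ∀ n, (s + 1) * ∑ i ∈ Finset.range (n + 1), e i =
      (n + 1) * Nat.choose (s + (n + 1)) s := by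
    intro n
    induction n with
    | zero =>
      rw [hc]
      simp [h0]
    | succ n ih =>
      have h1 := h n
      rw [ih] at h1
      have h2 : e (n + 1) = Nat.choose (s + (n + 1)) s :=
        mul_left_cancel₀ (by positivity) h1
      rw [Finset.sum_range_succ, mul_add, ih, h2]
      have h3 := hc (n + 1)
      push_cast at h3 ⊢
      linear_combination -h3
  cases n with
  | zero => simp [h0]
  | succ n =>
    have h1 := h n
    rw [key n] at h1
    exact mul_left_cancel₀ (by positivity) h1

theorem coeffSeries_plethExp_Qplus_zero (m₀ : ℕ) (hm : 1 ≤ m₀) :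
    coeffSeries m₀ (plethExp Qplus) 0 = (PowerSeries.invOneSubPow ℚ m₀).val := by
  obtain ⟨s, rfl⟩ := Nat.exists_eq_add_of_le' hm
  rw [PowerSeries.invOneSubPow_val_succ_eq_mk_add_choose]
  ext n
  rw [PowerSeries.coeff_mk]
  refine invOneSubPow_of_rec s (fun n => PowerSeries.coeff n _) ?_ ?_ n
  · simp [coeffSeries, plethExp_zero]
  · intro n
    have h := congrArg (fun f : Qmt => (f.coeff 0).eval ((s + 1 : ℕ) : ℚ))
      (plethExp_der Qplus 1 (n + 1))
    simp only [mul_one, Polynomial.coeff_add, coeff_eulerDer, Nat.cast_zero, zero_mul, zero_add,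
      Polynomial.finsetSum_coeff, Polynomial.mul_coeff_zero, Polynomial.eval_finsetSum,
      Polynomial.eval_mul, Polynomial.coeff_natCast_ite, if_true, Polynomial.eval_natCast] at h
    simp only [coeffSeries, PowerSeries.coeff_mk]
    push_cast at h ⊢
    rw [h, Finset.Nat.sum_antidiagonal_succ]
    simp only [Nat.divisors_zero, Finset.sum_empty, zero_mul, zero_add]
    have hd : ∀ i : ℕ, ∑ p ∈ (i + 1).divisors, (((tPow ((i + 1) / p)
        (eulerDer (Qplus p) + (p : Qmt) * Qplus p)).coeff 0).eval ((s : ℚ) + 1)) = s + 1 := by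
      intro i
      rw [Finset.sum_eq_single 1]
      · rw [coeff_tPow (by simp)]
        simp [Qplus_one, mPoly]
      · intro p hp hp1
        rw [coeff_tPow (Nat.div_pos (Nat.divisor_le hp) (Nat.pos_of_mem_divisors hp))]
        simp [coeff_eulerDer, coeff_zero_Qplus p hp1, Polynomial.mul_coeff_zero]
      · simp
    simp only [hd]
    rw [← Finset.mul_sum, ← Finset.Nat.sum_antidiagonal_swap]
    simp only [Prod.snd_swap]
    rw [Finset.Nat.sum_antidiagonal_eq_sum_range_succ
      (fun j _ => ((plethExp Qplus j).coeff 0).eval ((s : ℚ) + 1))]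

/-- The coefficients of `A` are `O(n ^ (s - 1))`; for `s = 0` this means that `A` has only
finitely many nonzero coefficients. -/
def PolyGrowth (s : ℕ) (A : PowerSeries ℚ) : Prop :=
  (s = 0 → ∃ N, ∀ n, N ≤ n → PowerSeries.coeff n A = 0) ∧
    (s ≠ 0 → ∃ C : ℚ, ∀ n, |PowerSeries.coeff n A| ≤ C * ((n : ℚ) + 1) ^ (s - 1))

namespace PolyGrowth

variable {s t : ℕ} {A B : PowerSeries ℚ}

theorem of_eventually_zero (N : ℕ) (h : ∀ n, N ≤ n → PowerSeries.coeff n A = 0) :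
    PolyGrowth s A := by
  refine ⟨fun _ => ⟨N, h⟩, fun _ => ⟨∑ i ∈ Finset.range N, |PowerSeries.coeff i A|, fun n => ?_⟩⟩
  have hC : 0 ≤ ∑ i ∈ Finset.range N, |PowerSeries.coeff i A| :=
    Finset.sum_nonneg fun _ _ => abs_nonneg _
  have h1 : (1 : ℚ) ≤ ((n : ℚ) + 1) ^ (s - 1) := one_le_pow₀ (by simp)
  rcases lt_or_ge n N with hn | hn
  · exact (Finset.single_le_sum (f := fun i => |PowerSeries.coeff i A|)
      (fun _ _ => abs_nonneg _) (Finset.mem_range.2 hn)).trans (le_mul_of_one_le_right hC h1)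
  · rw [h n hn, abs_zero]
    positivity

theorem zero : PolyGrowth s 0 := of_eventually_zero 0 (by simp)

theorem mono (hst : s ≤ t) (hA : PolyGrowth s A) : PolyGrowth t A := by
  rcases eq_or_ne s 0 with rfl | hs
  · obtain ⟨N, hN⟩ := hA.1 rfl
    exact of_eventually_zero N hN
  · obtain ⟨C, hC⟩ := hA.2 hs
    refine ⟨fun h => by omega, fun _ => ⟨C, fun n => (hC n).trans ?_⟩⟩
    have h0 : 0 ≤ C := by simpa using (abs_nonneg _).trans (hC 0)
    gcongr
    simp

theorem add (hA : PolyGrowth s A) (hB : PolyGrowth s B) : PolyGrowth s (A + B) := by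
  refine ⟨fun h => ?_, fun h => ?_⟩
  · obtain ⟨N, hN⟩ := hA.1 h
    obtain ⟨M, hM⟩ := hB.1 h
    exact ⟨max N M, fun n hn => by
      rw [map_add, hN n (le_of_max_le_left hn), hM n (le_of_max_le_right hn), add_zero]⟩
  · obtain ⟨N, hN⟩ := hA.2 h
    obtain ⟨M, hM⟩ := hB.2 h
    refine ⟨N + M, fun n => ?_⟩
    rw [map_add, add_mul]
    exact (abs_add_le _ _).trans (add_le_add (hN n) (hM n))

theorem smul (c : ℚ) (hA : PolyGrowth s A) : PolyGrowth s (c • A) := by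
  refine ⟨fun h => ?_, fun h => ?_⟩
  · obtain ⟨N, hN⟩ := hA.1 h
    exact ⟨N, fun n hn => by rw [map_smul, hN n hn, smul_zero]⟩
  · obtain ⟨N, hN⟩ := hA.2 h
    refine ⟨|c| * N, fun n => ?_⟩
    rw [map_smul, smul_eq_mul, abs_mul, mul_assoc]
    exact mul_le_mul_of_nonneg_left (hN n) (abs_nonneg c)

theorem neg (hA : PolyGrowth s A) : PolyGrowth s (-A) := by
  simpa using hA.smul (-1)

theorem sum {ι : Type*} (S : Finset ι) (F : ι → PowerSeries ℚ)
    (h : ∀ i ∈ S, PolyGrowth s (F i)) : PolyGrowth s (∑ i ∈ S, F i) :=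
  Finset.sum_induction F (PolyGrowth s) (fun _ _ => add) zero h

theorem dilate {d : ℕ} (hd : 0 < d) (hA : PolyGrowth s A) : PolyGrowth s (dilate d A) := by
  refine ⟨fun h => ?_, fun h => ?_⟩
  · obtain ⟨N, hN⟩ := hA.1 h
    refine ⟨N * d, fun n hn => ?_⟩
    rw [_root_.dilate, PowerSeries.coeff_mk, hN _ ((Nat.le_div_iff_mul_le hd).2 hn), ite_self]
  · obtain ⟨C, hC⟩ := hA.2 h
    refine ⟨C, fun n => ?_⟩
    have h0 : 0 ≤ C := by simpa using (abs_nonneg _).trans (hC 0)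
    rw [_root_.dilate, PowerSeries.coeff_mk]
    split_ifs
    · refine (hC _).trans ?_
      have : ((n / d : ℕ) : ℚ) ≤ n := by exact_mod_cast Nat.div_le_self n d
      gcongr
    · rw [abs_zero]
      positivity

theorem partial_sum (hA : PolyGrowth s A) :
    ∃ M : ℚ, 0 ≤ M ∧ ∀ n : ℕ, ∑ i ∈ Finset.range (n + 1), |PowerSeries.coeff i A| ≤
      M * ((n : ℚ) + 1) ^ s := by
  rcases eq_or_ne s 0 with rfl | hs
  · obtain ⟨N, hN⟩ := hA.1 rfl
    refine ⟨∑ i ∈ Finset.range N, |PowerSeries.coeff i A|,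
      Finset.sum_nonneg fun _ _ => abs_nonneg _, fun n => ?_⟩
    rw [pow_zero, mul_one]
    rcases le_total (n + 1) N with h | h
    · exact Finset.sum_le_sum_of_subset_of_nonneg (Finset.range_subset_range.2 h)
        fun _ _ _ => abs_nonneg _
    · refine (Finset.sum_subset (Finset.range_subset_range.2 h) fun i _ hi => ?_).ge
      rw [hN i (by simpa using hi), abs_zero]
  · obtain ⟨C, hC⟩ := hA.2 hs
    have h0 : 0 ≤ C := by simpa using (abs_nonneg _).trans (hC 0)
    refine ⟨C, h0, fun n => ?_⟩
    have h1 : ∀ i ∈ Finset.range (n + 1),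
        |PowerSeries.coeff i A| ≤ C * ((n : ℚ) + 1) ^ (s - 1) := by
      intro i hi
      refine (hC i).trans ?_
      have : (i : ℚ) ≤ n := by exact_mod_cast Nat.lt_succ_iff.1 (Finset.mem_range.1 hi)
      gcongr
    refine (Finset.sum_le_sum h1).trans_eq ?_
    rw [Finset.sum_const, Finset.card_range, nsmul_eq_mul, Nat.cast_succ]
    obtain ⟨r, rfl⟩ := Nat.exists_eq_succ_of_ne_zero hs
    simp only [Nat.succ_eq_add_one, Nat.add_sub_cancel, pow_succ]
    ring

theorem mul_of_ne_zero (ht : t ≠ 0) (hA : PolyGrowth s A) (hB : PolyGrowth t B) :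
    PolyGrowth (s + t) (A * B) := by
  refine ⟨fun h => by omega, fun _ => ?_⟩
  obtain ⟨M, hM0, hM⟩ := hA.partial_sum
  obtain ⟨C, hC⟩ := hB.2 ht
  have h0 : 0 ≤ C := by simpa using (abs_nonneg _).trans (hC 0)
  refine ⟨M * C, fun n => ?_⟩
  rw [PowerSeries.coeff_mul]
  calc _ ≤ ∑ p ∈ Finset.HasAntidiagonal.antidiagonal n,
        |PowerSeries.coeff p.1 A| * (C * ((n : ℚ) + 1) ^ (t - 1)) := by
        refine (Finset.abs_sum_le_sum_abs _ _).trans (Finset.sum_le_sum fun p hp => ?_)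
        rw [abs_mul]
        refine mul_le_mul_of_nonneg_left ((hC _).trans ?_) (abs_nonneg _)
        have : (p.2 : ℚ) ≤ n := by
          have := Finset.HasAntidiagonal.mem_antidiagonal.1 hp
          exact_mod_cast (by omega : p.2 ≤ n)
        gcongr
    _ = (∑ i ∈ Finset.range (n + 1), |PowerSeries.coeff i A|) *
        (C * ((n : ℚ) + 1) ^ (t - 1)) := by
        rw [← Finset.sum_mul, Finset.Nat.sum_antidiagonal_eq_sum_range_succ
          (fun i _ => |PowerSeries.coeff i A|)]
    _ ≤ M * ((n : ℚ) + 1) ^ s * (C * ((n : ℚ) + 1) ^ (t - 1)) := by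
        gcongr
        exact hM n
    _ = M * C * ((n : ℚ) + 1) ^ (s + t - 1) := by
        rw [Nat.add_sub_assoc (Nat.one_le_iff_ne_zero.2 ht), pow_add]
        ring

theorem mul (hA : PolyGrowth s A) (hB : PolyGrowth t B) : PolyGrowth (s + t) (A * B) := by
  rcases eq_or_ne t 0 with rfl | ht
  · rcases eq_or_ne s 0 with rfl | hs
    · obtain ⟨N, hN⟩ := hA.1 rfl
      obtain ⟨M, hM⟩ := hB.1 rfl
      refine of_eventually_zero (N + M) fun n hn => ?_
      rw [PowerSeries.coeff_mul]
      refine Finset.sum_eq_zero fun p hp => ?_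
      have hp := Finset.HasAntidiagonal.mem_antidiagonal.1 hp
      rcases le_or_gt N p.1 with h | h
      · rw [hN _ h, zero_mul]
      · rw [hM _ (by omega), mul_zero]
    · rw [add_comm, mul_comm]
      exact mul_of_ne_zero hs hB hA
  · exact mul_of_ne_zero ht hA hB

theorem invOneSubPow (s : ℕ) : PolyGrowth s (PowerSeries.invOneSubPow ℚ s).val := by
  induction s with
  | zero =>
    refine of_eventually_zero 1 fun n hn => ?_
    rw [PowerSeries.invOneSubPow_zero, Units.val_one, PowerSeries.coeff_one, if_neg (by omega)]
  | succ s ih =>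
    rw [PowerSeries.invOneSubPow_add, Units.val_mul]
    refine ih.mul ⟨by simp, fun _ => ⟨1, fun n => ?_⟩⟩
    rw [← zero_add 1, PowerSeries.invOneSubPow_val_succ_eq_mk_add_choose]
    simp

end PolyGrowth

/-- The series `A` equals `c / (1 - X) ^ s` up to terms with coefficients `O(n ^ (s - 2))`. -/
def HasLead (s : ℕ) (c : ℚ) (A : PowerSeries ℚ) : Prop :=
  PolyGrowth (s - 1) (A - c • (PowerSeries.invOneSubPow ℚ s).val)

namespace HasLead

variable {s t : ℕ} {c e : ℚ} {A B : PowerSeries ℚ}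

theorem polyGrowth (h : HasLead s c A) : PolyGrowth s A := by
  have := (PolyGrowth.mono (Nat.sub_le s 1) h).add ((PolyGrowth.invOneSubPow s).smul c)
  rwa [sub_add_cancel] at this

theorem add_polyGrowth (h : HasLead s c A) (hB : PolyGrowth (s - 1) B) : HasLead s c (A + B) := by
  have := PolyGrowth.add h hB
  rwa [sub_add_eq_add_sub] at this

theorem smul (r : ℚ) (h : HasLead s c A) : HasLead s (r * c) (r • A) := by
  have := PolyGrowth.smul r h
  rwa [smul_sub, smul_smul] at this

theorem zero : HasLead s 0 0 := by
  simpa [HasLead] using PolyGrowth.zero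

theorem add (hA : HasLead s c A) (hB : HasLead s e B) : HasLead s (c + e) (A + B) := by
  have := PolyGrowth.add hA hB
  rwa [sub_add_sub_comm, ← add_smul] at this

theorem sum {ι : Type*} (S : Finset ι) (F : ι → PowerSeries ℚ) (f : ι → ℚ)
    (h : ∀ i ∈ S, HasLead s (f i) (F i)) : HasLead s (∑ i ∈ S, f i) (∑ i ∈ S, F i) := by
  classical
  induction S using Finset.induction_on with
  | empty => simpa using zero
  | insert a S ha ih =>
    rw [Finset.sum_insert ha, Finset.sum_insert ha]
    exact (h a (by simp)).add (ih fun i hi => h i (by simp [hi]))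

theorem mul (hs : s ≠ 0) (ht : t ≠ 0) (hA : HasLead s c A) (hB : HasLead t e B) :
    HasLead (s + t) (c * e) (A * B) := by
  have h1 := (PolyGrowth.mul hA hB.polyGrowth).mono (show s - 1 + t ≤ s + t - 1 by omega)
  have h2 := (PolyGrowth.mul ((PolyGrowth.invOneSubPow s).smul c) hB).mono
    (show s + (t - 1) ≤ s + t - 1 by omega)
  have h3 := h1.add h2
  rw [HasLead]
  convert h3 using 1
  rw [PowerSeries.invOneSubPow_add, Units.val_mul, sub_mul, mul_sub, sub_add_sub_cancel,
    smul_mul_smul_comm]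

end HasLead

theorem sum_alternating_pow_div_factorial (n : ℕ) :
    ∑ p ∈ Finset.HasAntidiagonal.antidiagonal (n + 1),
      (-1 : ℚ) ^ p.2 * ((p.1 : ℚ) + 1) ^ n / (p.1.factorial * p.2.factorial) = 0 := by
  have h1 : (fwdDiff (1 : ℚ))^[n + 1] (fun x : ℚ => x ^ n) 1 = 0 := by
    rw [fwdDiff_iter_pow_eq_zero_of_lt (Nat.lt_succ_self n)]
    rfl
  rw [fwdDiff_iter_eq_sum_shift] at h1
  rw [Finset.Nat.sum_antidiagonal_eq_sum_range_succ
    (fun i j => (-1 : ℚ) ^ j * ((i : ℚ) + 1) ^ n / (i.factorial * j.factorial))]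
  have h2 := congrArg (fun x : ℚ => ((n + 1).factorial : ℚ)⁻¹ * x) h1
  simp only [mul_zero, Finset.mul_sum] at h2
  rw [← h2]
  refine Finset.sum_congr rfl fun i hi => ?_
  rw [zsmul_eq_mul, Int.cast_mul, Int.cast_natCast,
    Nat.cast_choose ℚ (Nat.lt_succ_iff.1 (Finset.mem_range.1 hi))]
  have := Nat.factorial_ne_zero (n + 1)
  have h3 := Nat.factorial_ne_zero i
  have h4 := Nat.factorial_ne_zero (n + 1 - i)
  push_cast
  field_simp
  simp only [nsmul_eq_mul, mul_one, add_comm]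

/-- **Abel's binomial theorem**, specialized and divided by `n!`. -/
theorem sum_ck_mul_shifted_pow (n : ℕ) :
    ∑ p ∈ Finset.HasAntidiagonal.antidiagonal n,
      Polynomial.C (ck p.1 / p.2.factorial) *
        (Polynomial.X + Polynomial.C (p.2 : ℚ)) ^ p.2 =
      Polynomial.C ((n.factorial : ℚ)⁻¹) * (Polynomial.X + Polynomial.C ((n : ℚ) + 1)) ^ n := by
  induction n with
  | zero => simp [ck]
  | succ n ih =>
    set P : Polynomial ℚ := ∑ p ∈ Finset.HasAntidiagonal.antidiagonal (n + 1),
      Polynomial.C (ck p.1 / p.2.factorial) * (Polynomial.X + Polynomial.C (p.2 : ℚ)) ^ p.2 with hP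
    set R : Polynomial ℚ := Polynomial.C (((n + 1).factorial : ℚ)⁻¹) *
      (Polynomial.X + Polynomial.C (((n + 1 : ℕ) : ℚ) + 1)) ^ (n + 1) with hR
    have hfac : ∀ l : ℕ, ((l + 1).factorial : ℚ)⁻¹ * (l + 1) = (l.factorial : ℚ)⁻¹ := by
      intro l
      have := Nat.factorial_ne_zero l
      rw [Nat.factorial_succ]
      push_cast
      field_simp
    have hder : P.derivative = R.derivative := by
      have h1 := congrArg (fun f : Polynomial ℚ => f.comp (Polynomial.X + 1)) ih
      simp only [Polynomial.sum_comp, Polynomial.mul_comp, Polynomial.C_comp,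
        Polynomial.pow_comp, Polynomial.add_comp, Polynomial.X_comp] at h1
      rw [hP, Finset.Nat.sum_antidiagonal_succ', hR]
      simp only [Polynomial.derivative_add, Polynomial.derivative_sum, Polynomial.derivative_mul,
        Polynomial.derivative_C, Polynomial.derivative_X_add_C_pow, zero_mul, zero_add,
        pow_zero, Polynomial.derivative_one, mul_zero, Nat.add_sub_cancel]
      have hsplit : ∀ (c : ℚ) (l : ℕ) (f : Polynomial ℚ),
          Polynomial.C (c * ((l + 1).factorial : ℚ)⁻¹) * (Polynomial.C ((l + 1 : ℕ) : ℚ) * f) =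
            Polynomial.C (c * (l.factorial : ℚ)⁻¹) * f := by
        intro c l f
        rw [← mul_assoc, ← Polynomial.C_mul, mul_assoc, Nat.cast_succ, hfac]
      have hR' := hsplit 1 n ((Polynomial.X + Polynomial.C (((n + 1 : ℕ) : ℚ) + 1)) ^ n)
      rw [one_mul, one_mul] at hR'
      rw [hR']
      simp only [div_eq_mul_inv] at h1 ⊢
      simp only [hsplit]
      have hX : ∀ c : ℚ, (Polynomial.X + 1 + Polynomial.C c : Polynomial ℚ) =
          Polynomial.X + Polynomial.C (c + 1) := by
        intro c
        rw [Polynomial.C_add, Polynomial.C_1]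
        ring
      simp only [hX] at h1
      push_cast
      rw [← h1]
    have hval : P.eval (-((n : ℚ) + 2)) = R.eval (-((n : ℚ) + 2)) := by
      have hRv : R.eval (-((n : ℚ) + 2)) = 0 := by
        rw [hR]
        simp only [Polynomial.eval_mul, Polynomial.eval_pow, Polynomial.eval_add,
          Polynomial.eval_X, Polynomial.eval_C]
        rw [show -((n : ℚ) + 2) + (((n + 1 : ℕ) : ℚ) + 1) = 0 by push_cast; ring,
          zero_pow (Nat.succ_ne_zero n), mul_zero]
      rw [hRv, hP, Polynomial.eval_finsetSum, ← sum_alternating_pow_div_factorial n]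
      refine Finset.sum_congr rfl fun p hp => ?_
      have hp := Finset.HasAntidiagonal.mem_antidiagonal.1 hp
      have hpq : (p.1 : ℚ) + p.2 = n + 1 := by exact_mod_cast hp
      simp only [Polynomial.eval_mul, Polynomial.eval_pow, Polynomial.eval_add,
          Polynomial.eval_X, Polynomial.eval_C, ck]
      rw [show -((n : ℚ) + 2) + p.2 = -1 * ((p.1 : ℚ) + 1) by linear_combination hpq, mul_pow]
      have h0 : ((p.1 : ℚ) + 1) ≠ 0 := by positivity
      have : ((p.1 : ℚ) + 1) ^ n = ((p.1 : ℚ) + 1) ^ ((p.1 : ℤ) - 1) * ((p.1 : ℚ) + 1) ^ p.2 := by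
        rw [← zpow_natCast, ← zpow_natCast, ← zpow_add₀ h0]
        congr 1
        omega
      rw [this]
      have h3 := Nat.factorial_ne_zero p.1
      have h4 := Nat.factorial_ne_zero p.2
      field_simp
    have hsub : (P - R).derivative = 0 := by rw [Polynomial.derivative_sub, hder, sub_self]
    have hC := Polynomial.eq_C_of_derivative_eq_zero hsub
    have hc : (P - R).eval (-((n : ℚ) + 2)) = 0 := by
      rw [Polynomial.eval_sub, hval, sub_self]
    rw [hC, Polynomial.eval_C] at hc
    rw [hc, Polynomial.C_0] at hC
    exact sub_eq_zero.1 hC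

theorem ck_zero : ck 0 = 1 := by simp [ck]

theorem sum_ck_convolution (n : ℕ) :
    ∑ p ∈ Finset.HasAntidiagonal.antidiagonal n, ((p.1 : ℚ) + 1) * ck p.1 * ck p.2 =
      (n + 1) * ck (n + 1) := by
  have h := congrArg (Polynomial.eval (1 : ℚ)) (sum_ck_mul_shifted_pow n)
  rw [Polynomial.eval_finsetSum] at h
  simp only [Polynomial.eval_mul, Polynomial.eval_pow, Polynomial.eval_add,
          Polynomial.eval_X, Polynomial.eval_C] at h
  rw [← Finset.Nat.sum_antidiagonal_swap]
  have h2 : ((n : ℚ) + 1) * ck (n + 1) = (n.factorial : ℚ)⁻¹ * (1 + ((n : ℚ) + 1)) ^ n := by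
    rw [ck, Nat.factorial_succ, show ((n + 1 : ℕ) : ℤ) - 1 = n by push_cast; ring, zpow_natCast]
    have h3 := Nat.factorial_ne_zero n
    push_cast
    field_simp
    ring
  rw [h2, ← h]
  refine Finset.sum_congr rfl fun p _ => ?_
  have h3 := Nat.factorial_ne_zero p.2
  have h0 : ((p.2 : ℚ) + 1) ≠ 0 := by positivity
  have : ((p.2 : ℚ) + 1) * ck p.2 = ((p.2 : ℚ) + 1) ^ p.2 / p.2.factorial := by
    rw [ck, zpow_sub_one₀ h0, zpow_natCast]
    field_simp
  simp only [Prod.fst_swap, Prod.snd_swap, this]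
  rw [add_comm (1 : ℚ)]
  ring

theorem ascFactorial_sub_pow (r : ℕ) :
    ∃ C : ℚ, ∀ n : ℕ, 1 ≤ n →
      |((n + 1).ascFactorial r : ℚ) - (n : ℚ) ^ r| * n ≤ C * (n : ℚ) ^ r := by
  induction r with
  | zero => exact ⟨0, fun n _ => by simp⟩
  | succ r ih =>
    obtain ⟨C, hC⟩ := ih
    refine ⟨(r + 2) * C + (r + 1), fun n hn => ?_⟩
    have hn' : (1 : ℚ) ≤ n := by exact_mod_cast hn
    have h1 := hC n hn
    have h0 : 0 ≤ |((n + 1).ascFactorial r : ℚ) - (n : ℚ) ^ r| * n := by positivity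
    have hr : (r : ℚ) ≤ r * n := le_mul_of_one_le_right (by positivity) hn'
    have hle : ((n : ℚ) + 1 + r) ≤ (r + 2) * n := by linarith
    calc |((n + 1).ascFactorial (r + 1) : ℚ) - (n : ℚ) ^ (r + 1)| * n
        = |((n : ℚ) + 1 + r) * (((n + 1).ascFactorial r : ℚ) - (n : ℚ) ^ r) +
            (r + 1) * (n : ℚ) ^ r| * n := by
          rw [Nat.ascFactorial_succ]
          push_cast
          ring_nf
      _ ≤ (((n : ℚ) + 1 + r) * |((n + 1).ascFactorial r : ℚ) - (n : ℚ) ^ r| +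
            (r + 1) * (n : ℚ) ^ r) * n := by
          gcongr
          refine (abs_add_le _ _).trans_eq ?_
          rw [abs_mul, abs_of_nonneg (a := (n : ℚ) + 1 + r) (by positivity),
            abs_of_nonneg (a := ((r : ℚ) + 1) * (n : ℚ) ^ r) (by positivity)]
      _ = ((n : ℚ) + 1 + r) * (|((n + 1).ascFactorial r : ℚ) - (n : ℚ) ^ r| * n) +
            (r + 1) * (n : ℚ) ^ (r + 1) := by ring
      _ ≤ (r + 2) * n * (C * (n : ℚ) ^ r) + (r + 1) * (n : ℚ) ^ (r + 1) := by gcongr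
      _ = ((r + 2) * C + (r + 1)) * (n : ℚ) ^ (r + 1) := by ring

theorem PolyGrowth.abs_coeff_mul_le {r : ℕ} {B : PowerSeries ℚ} (hB : PolyGrowth r B) :
    ∃ C : ℚ, ∀ n : ℕ, 1 ≤ n → |PowerSeries.coeff n B| * n ≤ C * (n : ℚ) ^ r := by
  rcases eq_or_ne r 0 with rfl | hr
  · obtain ⟨N, hN⟩ := hB.1 rfl
    refine ⟨(∑ i ∈ Finset.range N, |PowerSeries.coeff i B|) * N, fun n _ => ?_⟩
    have h0 : 0 ≤ ∑ i ∈ Finset.range N, |PowerSeries.coeff i B| :=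
      Finset.sum_nonneg fun _ _ => abs_nonneg _
    rw [pow_zero, mul_one]
    rcases lt_or_ge n N with h | h
    · have h1 := Finset.single_le_sum (f := fun i => |PowerSeries.coeff i B|)
        (fun _ _ => abs_nonneg _) (Finset.mem_range.2 h)
      exact mul_le_mul h1 (by exact_mod_cast h.le) (by positivity) h0
    · rw [hN n h, abs_zero, zero_mul]
      positivity
  · obtain ⟨C, hC⟩ := hB.2 hr
    obtain ⟨q, rfl⟩ := Nat.exists_eq_succ_of_ne_zero hr
    have h0 : 0 ≤ C := by simpa using (abs_nonneg _).trans (hC 0)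
    refine ⟨C * 2 ^ q, fun n hn => ?_⟩
    have hn' : (1 : ℚ) ≤ n := by exact_mod_cast hn
    calc |PowerSeries.coeff n B| * n ≤ C * ((n : ℚ) + 1) ^ q * n := by
          gcongr
          exact hC n
      _ ≤ C * (2 * (n : ℚ)) ^ q * n := by
          gcongr
          linarith
      _ = C * 2 ^ q * (n : ℚ) ^ (q + 1) := by ring

theorem HasLead.abs_coeff_sub_mul_le {r : ℕ} {c : ℚ} {A : PowerSeries ℚ}
    (h : HasLead (r + 1) c A) :
    ∃ C : ℚ, ∀ n : ℕ, 1 ≤ n →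
      |PowerSeries.coeff n A - c / r.factorial * (n : ℚ) ^ r| * n ≤ C * (n : ℚ) ^ r := by
  obtain ⟨C, hC⟩ := PolyGrowth.abs_coeff_mul_le h
  obtain ⟨D, hD⟩ := ascFactorial_sub_pow r
  refine ⟨C + |c / r.factorial| * D, fun n hn => ?_⟩
  have hf : (r.factorial : ℚ) ≠ 0 := by exact_mod_cast Nat.factorial_ne_zero r
  have hch : ((Nat.choose (r + n) r : ℕ) : ℚ) = ((n + 1).ascFactorial r : ℚ) / r.factorial := by
    rw [Nat.ascFactorial_eq_factorial_mul_choose, add_comm n r]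
    push_cast
    field_simp
  have h1 : PowerSeries.coeff n A - c / r.factorial * (n : ℚ) ^ r =
      PowerSeries.coeff n (A - c • (PowerSeries.invOneSubPow ℚ (r + 1)).val) +
        c / r.factorial * (((n + 1).ascFactorial r : ℚ) - (n : ℚ) ^ r) := by
    rw [map_sub, map_smul, PowerSeries.invOneSubPow_val_succ_eq_mk_add_choose,
      PowerSeries.coeff_mk, hch, smul_eq_mul]
    ring
  calc _ ≤ (|PowerSeries.coeff n (A - c • (PowerSeries.invOneSubPow ℚ (r + 1)).val)| +
        |c / r.factorial| * |((n + 1).ascFactorial r : ℚ) - (n : ℚ) ^ r|) * n := by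
        rw [h1, ← abs_mul]
        gcongr
        exact abs_add_le _ _
    _ = |PowerSeries.coeff n (A - c • (PowerSeries.invOneSubPow ℚ (r + 1)).val)| * n +
        |c / r.factorial| * (|((n + 1).ascFactorial r : ℚ) - (n : ℚ) ^ r| * n) := by ring
    _ ≤ C * (n : ℚ) ^ r + |c / r.factorial| * (D * (n : ℚ) ^ r) :=
        add_le_add (hC n hn) (mul_le_mul_of_nonneg_left (hD n hn) (abs_nonneg _))
    _ = (C + |c / r.factorial| * D) * (n : ℚ) ^ r := by ring

theorem dilate_one (A : PowerSeries ℚ) : dilate 1 A = A := by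
  ext n
  simp [dilate]

theorem logDerSeries_zero (m₀ : ℕ) (a : ℕ → Qmt) : logDerSeries m₀ a 0 = 0 := by
  simp [logDerSeries]

theorem polyGrowth_logDerSeries_sub (m₀ : ℕ) (a : ℕ → Qmt) (s : ℕ) {i : ℕ} (hi : i ≠ 0)
    (h : ∀ j < i, PolyGrowth s (coeffSeries m₀ a j)) :
    PolyGrowth s (logDerSeries m₀ a i - (i : ℚ) • coeffSeries m₀ a i) := by
  rw [logDerSeries, ← Finset.add_sum_erase _ _ (Nat.one_mem_divisors.2 hi), Nat.div_one,
    dilate_one, add_sub_cancel_left]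
  refine PolyGrowth.sum _ _ fun d hd => ?_
  obtain ⟨hd1, hd⟩ := Finset.mem_erase.1 hd
  have hd0 := Nat.pos_of_mem_divisors hd
  exact ((h _ (Nat.div_lt_self (Nat.pos_of_ne_zero hi) (by omega))).dilate hd0).smul _

theorem coeffSeries_X_mul_zero (m₀ : ℕ) (a : ℕ → Qmt) :
    coeffSeries m₀ (fun p => Polynomial.X * a p) 0 = 0 := by
  ext n
  simp [coeffSeries]

theorem coeffSeries_X_mul_succ (m₀ : ℕ) (a : ℕ → Qmt) (k : ℕ) :
    coeffSeries m₀ (fun p => Polynomial.X * a p) (k + 1) = coeffSeries m₀ a k := by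
  ext n
  simp [coeffSeries]

theorem coeffSeries_plethExp_X_mul_Qplus_zero (m₀ : ℕ) :
    coeffSeries m₀ (plethExp fun p => Polynomial.X * Qplus p) 0 = 1 := by
  ext n
  rw [coeffSeries, PowerSeries.coeff_mk, PowerSeries.coeff_one]
  match n with
  | 0 => simp [plethExp_zero]
  | 1 => simp [plethExp_one]
  | n + 2 =>
    rw [plethExp_X_mul_Qplus (by omega)]
    simp [Polynomial.mul_coeff_zero]

theorem polyGrowth_coeffSeries_plethExp_X_mul_Qplus_one (m₀ : ℕ) :
    PolyGrowth 0 (coeffSeries m₀ (plethExp fun p => Polynomial.X * Qplus p) 1) := by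
  refine PolyGrowth.of_eventually_zero 2 fun n hn => ?_
  rw [coeffSeries, PowerSeries.coeff_mk, plethExp_X_mul_Qplus hn, Polynomial.coeff_X_pow_mul',
    if_neg (by norm_num), Polynomial.eval_zero]

theorem polyGrowth_coeffSeries_plethExp_sub (m₀ k : ℕ) :
    PolyGrowth 0 (coeffSeries m₀ (plethExp fun p => Polynomial.X * Qplus p) (k + 2) -
      coeffSeries m₀ (plethExp Qplus) k) := by
  refine PolyGrowth.of_eventually_zero 2 fun n hn => ?_
  rw [map_sub, coeffSeries, coeffSeries, PowerSeries.coeff_mk, PowerSeries.coeff_mk,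
    plethExp_X_mul_Qplus hn, Polynomial.coeff_X_pow_mul, sub_self]

theorem polyGrowth_coeffSeries_Qplus_zero (m₀ : ℕ) :
    PolyGrowth 0 (coeffSeries m₀ Qplus 0) := by
  refine PolyGrowth.of_eventually_zero 2 fun n hn => ?_
  rw [coeffSeries, PowerSeries.coeff_mk, coeff_zero_Qplus n (by omega), Polynomial.eval_zero]

theorem hasLead_coeffSeries_Qplus_succ (m₀ k : ℕ) (hm : 1 ≤ m₀)
    (hE : ∀ j ≤ k, HasLead ((j + 1) * m₀) (ck j) (coeffSeries m₀ (plethExp Qplus) j))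
    (hF : ∀ j ≤ k, PolyGrowth (j * m₀) (coeffSeries m₀ Qplus j)) :
    HasLead ((k + 1) * m₀) (ck k) (coeffSeries m₀ Qplus (k + 1)) := by
  set b : ℕ → Qmt := fun p => Polynomial.X * Qplus p with hb
  have hG0 : coeffSeries m₀ (plethExp b) 0 = 1 := coeffSeries_plethExp_X_mul_Qplus_zero m₀
  have hG : ∀ j ≤ k + 1, PolyGrowth (j * m₀) (coeffSeries m₀ (plethExp b) (j + 1)) := by
    intro j hj
    cases j with
    | zero =>
      rw [zero_mul]
      exact polyGrowth_coeffSeries_plethExp_X_mul_Qplus_one m₀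
    | succ j =>
      have := ((polyGrowth_coeffSeries_plethExp_sub m₀ j).mono (Nat.zero_le _)).add
        (hE j (by omega)).polyGrowth
      rwa [sub_add_cancel] at this
  have hb' : ∀ i, i ≤ k → ∀ j < i + 2, PolyGrowth (i * m₀) (coeffSeries m₀ b j) := by
    intro i hi j hj
    cases j with
    | zero =>
      rw [hb, coeffSeries_X_mul_zero]
      exact PolyGrowth.zero
    | succ j =>
      rw [hb, coeffSeries_X_mul_succ]
      exact (hF j (by omega)).mono (Nat.mul_le_mul_right _ (by omega))
  have hL : ∀ i ≤ k, PolyGrowth (i * m₀) (logDerSeries m₀ b (i + 1)) := by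
    intro i hi
    have := (polyGrowth_logDerSeries_sub m₀ b (i * m₀) (Nat.succ_ne_zero i)
      fun j hj => hb' i hi j (by omega)).add ((hb' i hi (i + 1) (by omega)).smul ((i + 1 : ℕ) : ℚ))
    rwa [sub_add_cancel] at this
  have hrec := coeffSeries_plethExp_rec m₀ b (by simp [hb, Qplus_zero]) (k + 2)
  rw [Finset.Nat.sum_antidiagonal_succ', Finset.Nat.sum_antidiagonal_succ, hG0, mul_one,
    logDerSeries_zero, zero_mul, zero_add] at hrec
  have hS : PolyGrowth (k * m₀) (∑ p ∈ Finset.HasAntidiagonal.antidiagonal k,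
      logDerSeries m₀ b (p.1 + 1) * coeffSeries m₀ (plethExp b) (p.2 + 1)) := by
    refine PolyGrowth.sum _ _ fun p hp => ?_
    have hp := Finset.HasAntidiagonal.mem_antidiagonal.1 hp
    have := (hL p.1 (by omega)).mul (hG p.2 (by omega))
    rwa [← add_mul, hp] at this
  have hD := polyGrowth_logDerSeries_sub m₀ b (k * m₀) (Nat.succ_ne_zero (k + 1))
    fun j hj => hb' k le_rfl j (by omega)
  rw [show (k + 1).succ = k + 1 + 1 from rfl, hb, coeffSeries_X_mul_succ, ← hb] at hD
  have hk : ((k + 1 + 1 : ℕ) : ℚ) ≠ 0 := by positivity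
  have hle : k * m₀ ≤ (k + 1) * m₀ - 1 := by
    rw [add_mul, one_mul]
    omega
  have hdiff := (((hS.add hD).smul ((k + 1 + 1 : ℕ) : ℚ)⁻¹).neg).mono hle
  have hlead := ((hE k le_rfl).add_polyGrowth
    ((polyGrowth_coeffSeries_plethExp_sub m₀ k).mono (Nat.zero_le _))).add_polyGrowth hdiff
  convert hlead using 1
  rw [add_sub_cancel, ← hb]
  have := congrArg (fun A => ((k + 1 + 1 : ℕ) : ℚ)⁻¹ • A) hrec
  simp only [inv_smul_smul₀ hk] at this
  rw [show k + 2 = k + 1 + 1 from rfl] at this ⊢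
  rw [this, ← smul_neg, ← smul_add, eq_inv_smul_iff₀ hk]
  abel

theorem hasLead_coeffSeries_plethExp_succ (m₀ k : ℕ) (hm : 1 ≤ m₀)
    (hE : ∀ j ≤ k, HasLead ((j + 1) * m₀) (ck j) (coeffSeries m₀ (plethExp Qplus) j))
    (hF : ∀ j ≤ k, HasLead ((j + 1) * m₀) (ck j) (coeffSeries m₀ Qplus (j + 1))) :
    HasLead ((k + 2) * m₀) (ck (k + 1)) (coeffSeries m₀ (plethExp Qplus) (k + 1)) := by
  have hF' : ∀ j ≤ k + 1, PolyGrowth (j * m₀) (coeffSeries m₀ Qplus j) := by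
    intro j hj
    cases j with
    | zero =>
      rw [zero_mul]
      exact polyGrowth_coeffSeries_Qplus_zero m₀
    | succ j => exact (hF j (by omega)).polyGrowth
  have hL : ∀ i ≤ k, HasLead ((i + 1) * m₀) (((i : ℚ) + 1) * ck i)
      (logDerSeries m₀ Qplus (i + 1)) := by
    intro i hi
    have hle : i * m₀ ≤ (i + 1) * m₀ - 1 := by
      rw [add_mul, one_mul]
      omega
    have h1 := (polyGrowth_logDerSeries_sub m₀ Qplus (i * m₀) (Nat.succ_ne_zero i)
      fun j hj => (hF' j (by omega)).mono (Nat.mul_le_mul_right _ (by omega))).mono hle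
    have h2 := ((hF i hi).smul ((i + 1 : ℕ) : ℚ)).add_polyGrowth h1
    rw [add_sub_cancel] at h2
    exact_mod_cast h2
  have hrec := coeffSeries_plethExp_rec m₀ Qplus Qplus_zero (k + 1)
  rw [Finset.Nat.sum_antidiagonal_succ, logDerSeries_zero, zero_mul, zero_add] at hrec
  have hS : HasLead ((k + 2) * m₀) (((k : ℚ) + 1) * ck (k + 1))
      (∑ p ∈ Finset.HasAntidiagonal.antidiagonal k,
        logDerSeries m₀ Qplus (p.1 + 1) * coeffSeries m₀ (plethExp Qplus) p.2) := by
    rw [← sum_ck_convolution]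
    refine HasLead.sum _ _ _ fun p hp => ?_
    have hp := Finset.HasAntidiagonal.mem_antidiagonal.1 hp
    have := (hL p.1 (by omega)).mul (by positivity) (by positivity) (hE p.2 (by omega))
    rwa [← add_mul, show p.1 + 1 + (p.2 + 1) = k + 2 by omega] at this
  have hk : ((k : ℚ) + 1) ≠ 0 := by positivity
  rw [← hrec, Nat.cast_succ] at hS
  have := hS.smul ((k : ℚ) + 1)⁻¹
  rwa [inv_smul_smul₀ hk, inv_mul_cancel_left₀ hk] at this

theorem hasLead_coeffSeries_plethExp_Qplus (m₀ k : ℕ) (hm : 1 ≤ m₀) :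
    HasLead ((k + 1) * m₀) (ck k) (coeffSeries m₀ (plethExp Qplus) k) := by
  have key : ∀ k, HasLead ((k + 1) * m₀) (ck k) (coeffSeries m₀ (plethExp Qplus) k) ∧
      HasLead ((k + 1) * m₀) (ck k) (coeffSeries m₀ Qplus (k + 1)) := by
    intro k
    induction k using Nat.strong_induction_on with
    | _ k ih =>
      have hE : HasLead ((k + 1) * m₀) (ck k) (coeffSeries m₀ (plethExp Qplus) k) := by
        cases k with
        | zero =>
          rw [coeffSeries_plethExp_Qplus_zero m₀ hm, ck_zero, zero_add, one_mul, HasLead, one_smul,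
            sub_self]
          exact PolyGrowth.zero
        | succ k =>
          exact hasLead_coeffSeries_plethExp_succ m₀ k hm (fun j hj => (ih j (by omega)).1)
            fun j hj => (ih j (by omega)).2
      refine ⟨hE, hasLead_coeffSeries_Qplus_succ m₀ k hm (fun j hj => ?_) fun j hj => ?_⟩
      · rcases hj.eq_or_lt with rfl | h
        · exact hE
        · exact (ih j h).1
      · cases j with
        | zero =>
          rw [zero_mul]
          exact polyGrowth_coeffSeries_Qplus_zero m₀
        | succ j => exact (ih j (by omega)).2.polyGrowth
  exact (key k).1

/-- For fixed `m₀ ≥ 1` and `k ≥ 0`, as `n → ∞`,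
`𝒬_{n,k}(m₀) = (c_k/((k+1)m₀−1)!)·n^{(k+1)m₀−1} + O(n^{(k+1)m₀−2})`. -/
theorem Qnk_value_asymptotic (m₀ k : ℕ) (hm : 1 ≤ m₀) :
    ∃ C : ℚ, 0 < C ∧ ∀ n : ℕ, 1 ≤ n →
      |(Qnk n k).eval (m₀ : ℚ) -
          ck k / (((k + 1) * m₀ - 1).factorial : ℚ) *
            (n : ℚ) ^ (((k : ℤ) + 1) * (m₀ : ℤ) - 1)| ≤
        C * (n : ℚ) ^ (((k : ℤ) + 1) * (m₀ : ℤ) - 2) := by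
  have hpos : 1 ≤ (k + 1) * m₀ := Nat.mul_pos (Nat.succ_pos k) hm
  obtain ⟨r, hr⟩ := Nat.exists_eq_add_of_le' hpos
  have hlead := hasLead_coeffSeries_plethExp_Qplus m₀ k hm
  rw [hr] at hlead ⊢
  obtain ⟨C, hC⟩ := hlead.abs_coeff_sub_mul_le
  refine ⟨max C 1, by positivity, fun n hn => ?_⟩
  have hn0 : (0 : ℚ) < n := by exact_mod_cast hn
  have hz : ((k : ℤ) + 1) * (m₀ : ℤ) = r + 1 := by exact_mod_cast hr
  rw [hz, Nat.add_sub_cancel, add_sub_cancel_right, show (r : ℤ) + 1 - 2 = r - 1 by ring,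
    zpow_natCast, zpow_sub_one₀ hn0.ne', zpow_natCast, ← mul_assoc, ← div_eq_mul_inv,
    le_div_iff₀ hn0]
  have h1 := hC n hn
  rw [coeffSeries, PowerSeries.coeff_mk, ← Qfull_eq_plethExp] at h1
  exact h1.trans (mul_le_mul_of_nonneg_right (le_max_left _ _) (by positivity))
end

section
/- Fix integers m₀ ≥ 1 and k ≥ 0. Then as n → ∞, 𝒫_{n,k}(m₀) = (d_k/((k+1)m₀−1)!)·n^{(k+1)m₀−1} + o(n^{(k+1)m₀−1}); that is, (𝒫_{n,k}(m₀) − (d_k/((k+1)m₀−1)!)·n^{(k+1)m₀−1})/n^{(k+1)m₀−1} → 0 as n → ∞. -/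
open Polynomial

/-- The product over the distinct elements `p` of `s` of `e p (multiplicity of p)`. -/
def countProd {R : Type*} [CommRing R] (e : ℕ → ℕ → R) (s : Multiset ℕ) : R :=
  ∏ p ∈ s.toFinset, e p (s.count p)

theorem countProd_eq_prod_of_subset {R : Type*} [CommRing R] {e : ℕ → ℕ → R}
    (he0 : ∀ p, e p 0 = 1) {s : Multiset ℕ} {A : Finset ℕ} (h : s.toFinset ⊆ A) :
    countProd e s = ∏ p ∈ A, e p (s.count p) := by
  refine Finset.prod_subset h fun p _ hp => ?_
  rw [Multiset.mem_toFinset] at hp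
  rw [Multiset.count_eq_zero_of_notMem hp, he0]

theorem mul_countProd_eq_sum {R : Type*} [CommRing R] {e q : ℕ → ℕ → R}
    (he0 : ∀ p, e p 0 = 1)
    (he : ∀ p r : ℕ, 1 ≤ p → (p : R) * (r : R) * e p r = ∑ d ∈ Finset.Icc 1 r, q p d * e p (r - d))
    (s : Multiset ℕ) {p : ℕ} (hp : 1 ≤ p) :
    (p : R) * (s.count p : R) * countProd e s =
      ∑ d ∈ Finset.Icc 1 (s.count p), q p d * countProd e (s - Multiset.replicate d p) := by
  set A : Finset ℕ := insert p s.toFinset with hA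
  have key : ∀ u : Multiset ℕ, u ≤ s →
      countProd e u = e p (u.count p) * ∏ x ∈ A.erase p, e x (u.count x) := by
    intro u hu
    rw [countProd_eq_prod_of_subset he0 (A := A)
      ((Multiset.toFinset_subset.2 (Multiset.subset_of_le hu)).trans (Finset.subset_insert _ _)),
      Finset.mul_prod_erase A (fun x => e x (u.count x)) (Finset.mem_insert_self _ _)]
  rw [key s le_rfl, ← mul_assoc, he _ _ hp, Finset.sum_mul]
  refine Finset.sum_congr rfl fun d _ => ?_
  rw [key _ (Multiset.sub_le_self _ _), Multiset.count_sub, Multiset.count_replicate_self,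
    mul_assoc]
  congr 2
  refine Finset.prod_congr rfl fun x hx => ?_
  rw [Multiset.count_sub, Multiset.count_replicate, if_neg (Finset.ne_of_mem_erase hx).symm,
    Nat.sub_zero]

theorem Nat.Partition.sum_mul_count {n : ℕ} (lam : n.Partition) :
    ∑ p ∈ Finset.Icc 1 n, p * lam.parts.count p = n := by
  conv_rhs => rw [← lam.parts_sum, Finset.sum_multiset_count]
  symm
  simp only [smul_eq_mul, mul_comm]
  refine Finset.sum_subset (fun p hp => ?_) fun p _ hp => ?_
  · rw [Multiset.mem_toFinset] at hp
    exact Finset.mem_Icc.2 ⟨lam.parts_pos hp, lam.parts_sum ▸ Multiset.le_sum_of_mem hp⟩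
  · rw [Multiset.mem_toFinset] at hp
    simp [Multiset.count_eq_zero_of_notMem hp]

theorem Nat.Partition.mul_le_of_le_count {n d p : ℕ} (lam : n.Partition)
    (h : d ≤ lam.parts.count p) : p * d ≤ n := by
  obtain ⟨u, hu⟩ := Multiset.le_iff_exists_add.1 (Multiset.le_count_iff_replicate_le.1 h)
  have := lam.parts_sum
  rw [hu, Multiset.sum_add, Multiset.sum_replicate, smul_eq_mul] at this
  rw [mul_comm]; omega

theorem Nat.Partition.sum_filter_le_count {R : Type*} [AddCommMonoid R] (G : Multiset ℕ → R)
    {n d p : ℕ} (hp : 1 ≤ p) (h : p * d ≤ n) :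
    ∑ lam : n.Partition with d ≤ lam.parts.count p, G (lam.parts - Multiset.replicate d p) =
      ∑ mu : (n - p * d).Partition, G mu.parts := by
  refine Finset.sum_bij'
    (fun lam hl => ⟨lam.parts - Multiset.replicate d p, fun {i} hi =>
      lam.parts_pos (Multiset.mem_of_le (Multiset.sub_le_self _ _) hi), ?_⟩)
    (fun mu _ => ⟨mu.parts + Multiset.replicate d p, fun {i} hi => ?_, ?_⟩) ?_ ?_ ?_ ?_ ?_
  · have hl' := Multiset.le_count_iff_replicate_le.1 (Finset.mem_filter.1 hl).2
    obtain ⟨u, hu⟩ := Multiset.le_iff_exists_add.1 hl'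
    have := lam.parts_sum
    rw [hu, Multiset.sum_add, Multiset.sum_replicate, smul_eq_mul] at this
    rw [hu, add_tsub_cancel_left, mul_comm]; omega
  · rcases Multiset.mem_add.1 hi with hi | hi
    · exact mu.parts_pos hi
    · rw [Multiset.eq_of_mem_replicate hi]; exact hp
  · rw [Multiset.sum_add, Multiset.sum_replicate, mu.parts_sum, smul_eq_mul, mul_comm d]; omega
  · intros; exact Finset.mem_univ _
  · intros; simp
  · intro lam hl
    have hl' := Multiset.le_count_iff_replicate_le.1 (Finset.mem_filter.1 hl).2
    ext1
    exact tsub_add_cancel_of_le hl'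
  · intro mu _
    ext1
    exact add_tsub_cancel_right _ _
  · intros; rfl

/-- The Newton-type recursion for sums over partitions: if each factor `e p` satisfies a recursion
with power sums `q p`, so does the sum over all partitions, with a weight on the length. -/
theorem Nat.Partition.mul_sum_countProd {R : Type*} [CommRing R] {e q : ℕ → ℕ → R}
    (he0 : ∀ p, e p 0 = 1)
    (he : ∀ p r : ℕ, 1 ≤ p → (p : R) * (r : R) * e p r = ∑ d ∈ Finset.Icc 1 r, q p d * e p (r - d))
    (w : ℕ → R) (n : ℕ) :
    (n : R) * ∑ lam : n.Partition, w lam.parts.card * countProd e lam.parts =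
      ∑ p ∈ Finset.Icc 1 n, ∑ d ∈ Finset.Icc 1 n, if p * d ≤ n then
        q p d * ∑ mu : (n - p * d).Partition, w (mu.parts.card + d) * countProd e mu.parts
      else 0 := by
  have h1 : ∀ lam : n.Partition, (n : R) * (w lam.parts.card * countProd e lam.parts) =
      ∑ p ∈ Finset.Icc 1 n, ∑ d ∈ Finset.Icc 1 n, if d ≤ lam.parts.count p then
        q p d * (w ((lam.parts - Multiset.replicate d p).card + d) *
          countProd e (lam.parts - Multiset.replicate d p)) else 0 := by
    intro lam
    have hn : (n : R) = ∑ p ∈ Finset.Icc 1 n, (p : R) * (lam.parts.count p : R) := by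
      conv_lhs => rw [← lam.sum_mul_count]
      push_cast; rfl
    rw [hn, Finset.sum_mul]
    refine Finset.sum_congr rfl fun p hp => ?_
    rw [mul_left_comm, mul_countProd_eq_sum he0 he _ (Finset.mem_Icc.1 hp).1, Finset.mul_sum,
      ← Finset.sum_filter]
    have : (Finset.Icc 1 n).filter (fun d => d ≤ lam.parts.count p) =
        Finset.Icc 1 (lam.parts.count p) := by
      ext d
      simp only [Finset.mem_filter, Finset.mem_Icc]
      refine ⟨fun h => ⟨h.1.1, h.2⟩, fun h => ⟨⟨h.1, ?_⟩, h.2⟩⟩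
      exact (Nat.le_mul_of_pos_left d (Finset.mem_Icc.1 hp).1).trans (lam.mul_le_of_le_count h.2)
    rw [this]
    refine Finset.sum_congr rfl fun d hd => ?_
    have hle := Multiset.le_count_iff_replicate_le.1 (Finset.mem_Icc.1 hd).2
    have hc := Multiset.card_le_card hle
    rw [Multiset.card_replicate] at hc
    rw [Multiset.card_sub hle, Multiset.card_replicate, Nat.sub_add_cancel hc]
    ring
  rw [Finset.mul_sum, Finset.sum_congr rfl fun lam _ => h1 lam, Finset.sum_comm]
  refine Finset.sum_congr rfl fun p hp => ?_
  rw [Finset.sum_comm]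
  refine Finset.sum_congr rfl fun d _ => ?_
  split_ifs with h
  · rw [← Nat.Partition.sum_filter_le_count (fun s => w (s.card + d) * countProd e s)
      (Finset.mem_Icc.1 hp).1 h, Finset.mul_sum, Finset.sum_filter]
  · refine Finset.sum_eq_zero fun lam _ => if_neg fun h' => h (lam.mul_le_of_le_count h')

theorem plethH_eq_sum_countProd (r : ℕ) (f : Qmt) :
    plethH r f = ∑ mu : r.Partition,
      countProd (fun i c => C (C (((i : ℚ) ^ c * c.factorial)⁻¹)) * tPow i f ^ c) mu.parts := by
  refine Finset.sum_congr rfl fun mu _ => ?_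
  simp only [countProd, zPart, tPowMul, Finset.prod_mul_distrib]
  rw [Finset.prod_multiset_map_count, ← map_prod, ← map_prod]
  push_cast
  simp only [← Finset.prod_inv_distrib, Finset.prod_mul_distrib, mul_inv]

theorem natCast_mul_plethH (r : ℕ) (f : Qmt) :
    (r : Qmt) * plethH r f = ∑ d ∈ Finset.Icc 1 r, tPow d f * plethH (r - d) f := by
  have key := Nat.Partition.mul_sum_countProd
    (e := fun i c => C (C (((i : ℚ) ^ c * c.factorial)⁻¹)) * tPow i f ^ c)
    (q := fun i d => if d = 1 then tPow i f else 0) (by simp) (fun i c hi => ?_)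
    (fun _ => 1) r
  · simp only [one_mul, ← plethH_eq_sum_countProd] at key
    rw [key]
    refine Finset.sum_congr rfl fun p hp => ?_
    rw [Finset.mem_Icc] at hp
    rw [Finset.sum_eq_single 1]
    · simp [hp.2]
    · intro d _ hd
      simp [hd]
    · simp; omega
  · rcases c with _ | c
    · simp
    · rw [Finset.sum_eq_single 1 (by intro d _ hd; simp [hd]) (by simp)]
      have hi' : (i : ℚ) ≠ 0 := by positivity
      have : (i : ℚ) * ((c + 1 : ℕ) : ℚ) * ((i : ℚ) ^ (c + 1) * (c + 1).factorial)⁻¹ =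
          ((i : ℚ) ^ c * c.factorial)⁻¹ := by
        rw [Nat.factorial_succ]; push_cast; field_simp; ring
      simp only [if_true, Nat.add_sub_cancel]
      rw [← this]
      simp only [map_mul, map_natCast]
      ring

/-- The sum over partitions of `n` of `∏ h_{r_j} ∘ 𝒬⁺_{n_j}`, weighted by a function of the
length. -/
noncomputable def Qweighted (w : ℕ → Qmt) (n : ℕ) : Qmt :=
  ∑ lam : n.Partition, w lam.parts.card * countProd (fun p r => plethH r (Qplus p)) lam.parts

theorem natCast_mul_Qweighted (w : ℕ → Qmt) (n : ℕ) :
    (n : Qmt) * Qweighted w n = ∑ p ∈ Finset.Icc 1 n, ∑ d ∈ Finset.Icc 1 n, if p * d ≤ n then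
        p * tPow d (Qplus p) * Qweighted (fun l => w (l + d)) (n - p * d) else 0 := by
  refine Nat.Partition.mul_sum_countProd (q := fun p d => p * tPow d (Qplus p))
    (fun p => plethH_zero _) (fun p r _ => ?_) w n
  rw [mul_assoc, natCast_mul_plethH, Finset.mul_sum]
  exact Finset.sum_congr rfl fun d _ => (mul_assoc _ _ _).symm

theorem Nat.Partition.eq_indiscrete_of_mem {n : ℕ} (lam : n.Partition) (hn : n ∈ lam.parts) :
    lam.parts = {n} := by
  obtain ⟨u, hu⟩ := Multiset.exists_cons_of_mem hn
  have h := lam.parts_sum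
  rw [hu, Multiset.sum_cons] at h
  have : u = 0 := by
    refine Multiset.eq_zero_of_forall_notMem fun x hx => ?_
    have h1 := Multiset.le_sum_of_mem hx
    have h2 := lam.parts_pos (i := x) (by rw [hu]; exact Multiset.mem_cons_of_mem hx)
    omega
  rw [hu, this]; rfl

theorem Qplus_eq_s1 {n : ℕ} (hn : n ≠ 1) :
    Qplus n = Qweighted (fun l => ∑ i ∈ Finset.Icc 1 (l - 2), X ^ i) n := by
  rw [Qplus, Nat.strongRecOn_eq, if_neg hn]
  refine Finset.sum_congr rfl fun lam _ => ?_
  by_cases h : n ∈ lam.parts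
  · simp [lam.eq_indiscrete_of_mem h]
  · congr 1
    refine Finset.prod_congr rfl fun p hp => ?_
    rw [Multiset.mem_toFinset] at hp
    have : p < n := lt_of_le_of_ne (lam.parts_sum ▸ Multiset.le_sum_of_mem hp)
      fun e => h (e ▸ hp)
    rw [dif_pos this]
    rfl

theorem Qfull_eq {n : ℕ} (hn : n ≠ 1) : Qfull n = Qweighted (fun _ => 1) n := by
  rw [Qfull, if_neg hn]
  exact Finset.sum_congr rfl fun lam _ => (one_mul _).symm

open Finset.HasAntidiagonal (antidiagonal mem_antidiagonal)

/-- The coefficient `(D + n choose D)` of `x ^ n` in `(1 - x) ^ (-(D + 1))`. -/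
def poleCoeff (D n : ℕ) : ℚ := ((D + n).choose D : ℚ)

theorem poleCoeff_pos (D n : ℕ) : 0 < poleCoeff D n := by
  unfold poleCoeff
  exact_mod_cast Nat.choose_pos (Nat.le_add_right D n)

theorem poleCoeff_mono (D : ℕ) {i n : ℕ} (h : i ≤ n) : poleCoeff D i ≤ poleCoeff D n := by
  unfold poleCoeff
  exact_mod_cast Nat.choose_le_choose D (Nat.add_le_add_left h D)

theorem poleCoeff_succ (D n : ℕ) :
    poleCoeff (D + 1) n * (D + 1) = poleCoeff D n * (D + 1 + n) := by
  have := Nat.add_one_mul_choose_eq (D + n) D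
  unfold poleCoeff
  rw [show D + 1 + n = D + n + 1 by ring, mul_comm ((D + n).choose D : ℚ)]
  have h : (((D + n + 1) * (D + n).choose D : ℕ) : ℚ) =
    (((D + n + 1).choose (D + 1) * (D + 1) : ℕ) : ℚ) := by rw [this]
  push_cast at h
  linarith

theorem coeff_invOneSubPow_succ (D n : ℕ) :
    PowerSeries.coeff n (PowerSeries.invOneSubPow ℚ (D + 1)).val = poleCoeff D n := by
  rw [PowerSeries.invOneSubPow_val_succ_eq_mk_add_choose, PowerSeries.coeff_mk, poleCoeff]

theorem sum_antidiagonal_poleCoeff (D E n : ℕ) :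
    ∑ x ∈ antidiagonal n, poleCoeff D x.1 * poleCoeff E x.2 = poleCoeff (D + E + 1) n := by
  rw [← coeff_invOneSubPow_succ, show D + E + 1 + 1 = (D + 1) + (E + 1) by ring,
    PowerSeries.invOneSubPow_add, Units.val_mul, PowerSeries.coeff_mul]
  simp only [coeff_invOneSubPow_succ]

theorem tendsto_poleCoeff_div_succ (D : ℕ) :
    Filter.Tendsto (fun n => poleCoeff D n / poleCoeff (D + 1) n) Filter.atTop (nhds 0) := by
  have h : ∀ n, poleCoeff D n / poleCoeff (D + 1) n = ((D : ℚ) + 1) / ((n : ℚ) + (D + 1)) := by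
    intro n
    have := poleCoeff_succ D n
    have h1 := poleCoeff_pos (D + 1) n
    rw [div_eq_div_iff h1.ne' (by positivity)]
    linarith
  simp only [h]
  exact Filter.Tendsto.const_div_atTop
    (Filter.tendsto_atTop_add_const_right _ _ tendsto_natCast_atTop_atTop) _

/-- `f` behaves like `a * (1 - x) ^ (-D)`: for `D = 0` it is the constant `a`, and for `D ≥ 1` its
coefficients are asymptotic to `a` times those of `(1 - x) ^ (-D)`. -/
def PoleLike : ℕ → ℚ → PowerSeries ℚ → Prop
  | 0, a, f => f = PowerSeries.C a
  | D + 1, a, f => Filter.Tendsto (fun n => PowerSeries.coeff n f / poleCoeff D n)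
      Filter.atTop (nhds a)

namespace PoleLike

theorem congr {D : ℕ} {a b : ℚ} {f : PowerSeries ℚ} (h : PoleLike D a f) (hab : a = b) :
    PoleLike D b f := hab ▸ h

theorem invOneSubPow (D : ℕ) : PoleLike D 1 (PowerSeries.invOneSubPow ℚ D).val := by
  cases D with
  | zero => simp [PoleLike, PowerSeries.invOneSubPow_zero]
  | succ D =>
    simp only [PoleLike, coeff_invOneSubPow_succ, div_self (poleCoeff_pos D _).ne']
    exact tendsto_const_nhds

theorem zero (D : ℕ) : PoleLike D 0 0 := by
  cases D <;> simp [PoleLike]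

theorem add {D : ℕ} {a b : ℚ} {f g : PowerSeries ℚ} (hf : PoleLike D a f) (hg : PoleLike D b g) :
    PoleLike D (a + b) (f + g) := by
  cases D with
  | zero => simp_all [PoleLike]
  | succ D => simpa [PoleLike, add_div] using Filter.Tendsto.add hf hg

theorem C_mul {D : ℕ} {a : ℚ} {f : PowerSeries ℚ} (c : ℚ) (hf : PoleLike D a f) :
    PoleLike D (c * a) (PowerSeries.C c * f) := by
  cases D with
  | zero => simp_all [PoleLike]
  | succ D => simpa [PoleLike, mul_div_assoc] using Filter.Tendsto.const_mul c hf

theorem sub {D : ℕ} {a b : ℚ} {f g : PowerSeries ℚ} (hf : PoleLike D a f) (hg : PoleLike D b g) :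
    PoleLike D (a - b) (f - g) := by
  cases D with
  | zero => simp_all [PoleLike]
  | succ D => simpa [PoleLike, sub_div] using Filter.Tendsto.sub hf hg

theorem sum {ι : Type*} {D : ℕ} (s : Finset ι) {a : ι → ℚ} {f : ι → PowerSeries ℚ}
    (h : ∀ i ∈ s, PoleLike D (a i) (f i)) : PoleLike D (∑ i ∈ s, a i) (∑ i ∈ s, f i) := by
  classical
  induction s using Finset.induction_on with
  | empty => simpa using zero D
  | insert i s hi ih =>
    rw [Finset.sum_insert hi, Finset.sum_insert hi]
    exact (h i (Finset.mem_insert_self _ _)).add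
      (ih fun j hj => h j (Finset.mem_insert_of_mem hj))

theorem congr_coeff {D : ℕ} {a : ℚ} {f g : PowerSeries ℚ} (hf : PoleLike D a f) (hD : 1 ≤ D)
    (h : ∀ᶠ n in Filter.atTop, PowerSeries.coeff n f = PowerSeries.coeff n g) :
    PoleLike D a g := by
  obtain ⟨D, rfl⟩ := Nat.exists_eq_succ_of_ne_zero (by omega : D ≠ 0)
  exact Filter.Tendsto.congr' (h.mono fun n hn => by rw [hn]) hf

theorem squeeze {D : ℕ} {f g : PowerSeries ℚ} (hf : PoleLike D 0 f) (hD : 1 ≤ D)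
    (h : ∀ᶠ n in Filter.atTop, 0 ≤ PowerSeries.coeff n g ∧
      PowerSeries.coeff n g ≤ PowerSeries.coeff n f) : PoleLike D 0 g := by
  obtain ⟨D, rfl⟩ := Nat.exists_eq_succ_of_ne_zero (by omega : D ≠ 0)
  refine tendsto_of_tendsto_of_tendsto_of_le_of_le' tendsto_const_nhds hf
    (h.mono fun n hn => div_nonneg hn.1 (poleCoeff_pos D n).le)
    (h.mono fun n hn => div_le_div_of_nonneg_right hn.2 (poleCoeff_pos D n).le)

theorem exists_bound {D : ℕ} {a : ℚ} {f : PowerSeries ℚ} (hf : PoleLike (D + 1) a f) :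
    ∃ K, 0 ≤ K ∧ ∀ n, |PowerSeries.coeff n f| ≤ K * poleCoeff D n := by
  obtain ⟨K, hK⟩ := (Filter.Tendsto.abs hf).bddAbove_range
  have hK' : ∀ n, |PowerSeries.coeff n f| ≤ K * poleCoeff D n := by
    intro n
    have := hK (Set.mem_range_self n)
    simp only [abs_div, abs_of_pos (poleCoeff_pos D n)] at this
    rwa [div_le_iff₀ (poleCoeff_pos D n)] at this
  refine ⟨K, ?_, hK'⟩
  by_contra hneg
  have := (abs_nonneg _).trans (hK' 0)
  exact absurd this (not_le.2 (mul_neg_of_neg_of_pos (not_le.1 hneg) (poleCoeff_pos D 0)))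

theorem of_bound {D : ℕ} {K : ℚ} {f : PowerSeries ℚ}
    (hf : ∀ n, |PowerSeries.coeff n f| ≤ K * poleCoeff D n) : PoleLike (D + 2) 0 f := by
  have hlim := (tendsto_poleCoeff_div_succ D).const_mul K
  rw [mul_zero] at hlim
  have habs : ∀ n, |PowerSeries.coeff n f / poleCoeff (D + 1) n| ≤
      K * (poleCoeff D n / poleCoeff (D + 1) n) := fun n => by
    rw [abs_div, abs_of_pos (poleCoeff_pos (D + 1) n), ← mul_div_assoc]
    exact div_le_div_of_nonneg_right (hf n) (poleCoeff_pos (D + 1) n).le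
  refine tendsto_of_tendsto_of_tendsto_of_le_of_le (by simpa using hlim.neg) hlim
    (fun n => (abs_le.1 (habs n)).1) (fun n => (abs_le.1 (habs n)).2)

theorem succ {D : ℕ} {a : ℚ} {f : PowerSeries ℚ} (hf : PoleLike D a f) :
    PoleLike (D + 1) 0 f := by
  cases D with
  | zero =>
    refine tendsto_const_nhds.congr' ?_
    filter_upwards [Filter.eventually_ge_atTop 1] with n hn
    rw [show f = PowerSeries.C a from hf, PowerSeries.coeff_C_of_ne_zero (by omega), zero_div]
  | succ D =>
    obtain ⟨K, -, hK⟩ := hf.exists_bound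
    exact of_bound hK

theorem mono {D E : ℕ} {a : ℚ} {f : PowerSeries ℚ} (hf : PoleLike D a f) (h : D < E) :
    PoleLike E 0 f := by
  induction E, h using Nat.le_induction with
  | base => exact hf.succ
  | succ E _ ih => exact ih.succ

theorem mono_zero {D E : ℕ} {f : PowerSeries ℚ} (hf : PoleLike D 0 f) (h : D ≤ E) :
    PoleLike E 0 f := by
  rcases h.eq_or_lt with rfl | h
  exacts [hf, hf.mono h]

theorem mul_of_zero {D E : ℕ} {a : ℚ} {f g : PowerSeries ℚ} (hf : PoleLike (D + 1) 0 f)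
    (hg : PoleLike (E + 1) a g) : PoleLike (D + 1 + (E + 1)) 0 (f * g) := by
  obtain ⟨K, hK0, hK⟩ := hg.exists_bound
  obtain ⟨M, hM0, hM⟩ := hf.exists_bound
  have hbound : ∀ ε > 0, ∃ B : ℚ, ∀ n, |PowerSeries.coeff n (f * g)| ≤
      ε * K * poleCoeff (D + E + 1) n + B * poleCoeff E n := by
    intro ε hε
    obtain ⟨N, hN⟩ := Filter.eventually_atTop.1 ((tendsto_order.1 (Filter.Tendsto.abs hf)).2 ε
      (by simpa using hε))
    refine ⟨M * poleCoeff D N * K * N, fun n => ?_⟩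
    have hterm : ∀ x ∈ antidiagonal n,
        |PowerSeries.coeff x.1 f * PowerSeries.coeff x.2 g| ≤
          ε * K * (poleCoeff D x.1 * poleCoeff E x.2) +
            if x.1 < N then M * poleCoeff D N * K * poleCoeff E n else 0 := by
      intro x hx
      have hx2 : x.2 ≤ n := by rw [← mem_antidiagonal.1 hx]; omega
      have hD := poleCoeff_pos D x.1
      have hDN := poleCoeff_pos D N
      have hE := poleCoeff_pos E x.2
      have hKE : 0 ≤ K * poleCoeff E x.2 := mul_nonneg hK0 hE.le
      rw [abs_mul]
      split_ifs with h
      · have h1 : |PowerSeries.coeff x.1 f| ≤ M * poleCoeff D N :=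
          (hM _).trans (mul_le_mul_of_nonneg_left (poleCoeff_mono D h.le) hM0)
        have h2 : |PowerSeries.coeff x.2 g| ≤ K * poleCoeff E n :=
          (hK _).trans (mul_le_mul_of_nonneg_left (poleCoeff_mono E hx2) hK0)
        have h3 := mul_le_mul h1 h2 (abs_nonneg _) (by positivity)
        have h4 : 0 ≤ ε * K * (poleCoeff D x.1 * poleCoeff E x.2) := by positivity
        linarith
      · have h1 := hN x.1 (not_lt.1 h)
        rw [abs_div, abs_of_pos hD, div_lt_iff₀ hD] at h1
        have h3 := mul_le_mul h1.le (hK x.2) (abs_nonneg _) (by positivity)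
        linarith
    rw [PowerSeries.coeff_mul]
    refine (Finset.abs_sum_le_sum_abs _ _).trans ((Finset.sum_le_sum hterm).trans ?_)
    rw [Finset.sum_add_distrib, ← Finset.mul_sum, sum_antidiagonal_poleCoeff,
      ← Finset.sum_filter, Finset.sum_const, nsmul_eq_mul]
    have hcard : ((antidiagonal n).filter (fun x => x.1 < N)).card ≤ N := by
      refine (Finset.card_le_card_of_injOn (t := Finset.range N) Prod.fst (fun x hx => ?_)
        fun x hx y hy hxy => ?_).trans_eq (Finset.card_range N)
      · simpa using (Finset.mem_filter.1 hx).2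
      · have h1 := mem_antidiagonal.1 (Finset.mem_filter.1 hx).1
        have h2 := mem_antidiagonal.1 (Finset.mem_filter.1 hy).1
        ext <;> omega
    have hnn : 0 ≤ M * poleCoeff D N * K * poleCoeff E n := by
      have := poleCoeff_pos D N
      have := poleCoeff_pos E n
      positivity
    have := mul_le_mul_of_nonneg_right (Nat.cast_le (α := ℚ).2 hcard) hnn
    linarith
  have hlim : Filter.Tendsto (fun n => poleCoeff E n / poleCoeff (D + E + 1) n)
      Filter.atTop (nhds 0) := by
    have h := (invOneSubPow (E + 1)).mono (show E + 1 < D + E + 1 + 1 by omega)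
    simpa only [PoleLike, coeff_invOneSubPow_succ] using h
  rw [show D + 1 + (E + 1) = D + E + 1 + 1 by ring]
  rw [PoleLike, tendsto_order]
  have hsmall : ∀ δ > 0, ∀ᶠ n in Filter.atTop,
      |PowerSeries.coeff n (f * g) / poleCoeff (D + E + 1) n| < δ := by
    intro δ hδ
    have hε : 0 < δ / (2 * (K + 1)) := by positivity
    obtain ⟨B, hB⟩ := hbound _ hε
    have hlim' := hlim.const_mul B
    rw [mul_zero] at hlim'
    filter_upwards [(tendsto_order.1 hlim').2 (δ / 2) (by positivity)] with n hn
    have hp := poleCoeff_pos (D + E + 1) n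
    rw [abs_div, abs_of_pos hp, div_lt_iff₀ hp]
    rw [← mul_div_assoc, div_lt_iff₀ hp] at hn
    have h1 : δ / (2 * (K + 1)) * K ≤ δ / 2 := by
      rw [div_mul_eq_mul_div, div_le_div_iff₀ (by positivity) (by positivity)]
      nlinarith
    have h2 := mul_le_mul_of_nonneg_right h1 hp.le
    have := hB n
    linarith
  refine ⟨fun b hb => ?_, fun b hb => ?_⟩
  · filter_upwards [hsmall (-b) (by linarith)] with n hn
    linarith [(abs_lt.1 hn).1]
  · filter_upwards [hsmall b hb] with n hn
    exact (abs_lt.1 hn).2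

theorem mul {D E : ℕ} {a b : ℚ} {f g : PowerSeries ℚ} (hf : PoleLike D a f)
    (hg : PoleLike E b g) : PoleLike (D + E) (a * b) (f * g) := by
  rcases D with _ | D
  · rw [show f = PowerSeries.C a from hf, zero_add]
    exact hg.C_mul a
  rcases E with _ | E
  · rw [show g = PowerSeries.C b from hg, mul_comm a, mul_comm f]
    exact hf.C_mul b
  have hf' : PoleLike (D + 1) 0
      (f - PowerSeries.C a * (PowerSeries.invOneSubPow ℚ (D + 1)).val) :=
    (hf.sub ((invOneSubPow (D + 1)).C_mul a)).congr (by ring)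
  have hg' : PoleLike (E + 1) 0
      (g - PowerSeries.C b * (PowerSeries.invOneSubPow ℚ (E + 1)).val) :=
    (hg.sub ((invOneSubPow (E + 1)).C_mul b)).congr (by ring)
  have h1 := hf'.mul_of_zero hg
  have h2 := (hg'.mul_of_zero (invOneSubPow (D + 1))).C_mul a
  rw [add_comm (E + 1)] at h2
  have h3 := (invOneSubPow (D + 1 + (E + 1))).C_mul (a * b)
  rw [PowerSeries.invOneSubPow_add, Units.val_mul] at h3
  have h4 := (h1.add h2).add h3
  have e : f * g = (f - PowerSeries.C a * (PowerSeries.invOneSubPow ℚ (D + 1)).val) * g +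
      PowerSeries.C a * ((g - PowerSeries.C b * (PowerSeries.invOneSubPow ℚ (E + 1)).val) *
        (PowerSeries.invOneSubPow ℚ (D + 1)).val) +
      PowerSeries.C (a * b) * ((PowerSeries.invOneSubPow ℚ (D + 1)).val *
        (PowerSeries.invOneSubPow ℚ (E + 1)).val) := by
    rw [map_mul]; ring
  rw [e]
  exact h4.congr (by ring)

end PoleLike

/-- The Euler operator `x d/dx`. -/
noncomputable def eulerOp (f : PowerSeries ℚ) : PowerSeries ℚ :=
  PowerSeries.X * PowerSeries.derivative ℚ f

theorem coeff_eulerOp (f : PowerSeries ℚ) (n : ℕ) :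
    PowerSeries.coeff n (eulerOp f) = n * PowerSeries.coeff n f := by
  rcases n with _ | n
  · simp [eulerOp]
  · rw [eulerOp, PowerSeries.coeff_succ_X_mul, PowerSeries.coeff_derivative]
    push_cast; ring

theorem eulerOp_mul (f g : PowerSeries ℚ) : eulerOp (f * g) = eulerOp f * g + f * eulerOp g := by
  simp only [eulerOp, Derivation.leibniz, smul_eq_mul]
  ring

/-- The power series `f(x ^ d)`. -/
noncomputable def expandSeries (d : ℕ) (f : PowerSeries ℚ) : PowerSeries ℚ :=
  PowerSeries.mk fun n => if d ∣ n then PowerSeries.coeff (n / d) f else 0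

namespace PoleLike

theorem eulerOp_iff {D : ℕ} {a : ℚ} {f : PowerSeries ℚ} :
    PoleLike (D + 2) ((D + 1) * a) (eulerOp f) ↔ PoleLike (D + 1) a f := by
  have key : ∀ᶠ n : ℕ in Filter.atTop, PowerSeries.coeff n f / poleCoeff D n =
      PowerSeries.coeff n (eulerOp f) / poleCoeff (D + 1) n * (((D : ℚ) + 1 + n) / n) / (D + 1) := by
    filter_upwards [Filter.eventually_ge_atTop 1] with n hn
    have hn' : (n : ℚ) ≠ 0 := by positivity
    have h0 := poleCoeff_pos D n
    have h2 : poleCoeff (D + 1) n = poleCoeff D n * (D + 1 + n) / (D + 1) := by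
      rw [← poleCoeff_succ]; field_simp
    rw [coeff_eulerOp, h2]
    field_simp
  have hr : Filter.Tendsto (fun n : ℕ => ((D : ℚ) + 1 + n) / n) Filter.atTop (nhds 1) := by
    have h := (tendsto_const_div_atTop_nhds_zero_nat (𝕜 := ℚ) ((D : ℚ) + 1)).add_const 1
    rw [zero_add] at h
    refine h.congr' ?_
    filter_upwards [Filter.eventually_ge_atTop 1] with n hn
    have hn' : (n : ℚ) ≠ 0 := by positivity
    field_simp
  have hD : (D : ℚ) + 1 ≠ 0 := by positivity
  constructor
  · intro h
    have h1 := ((Filter.Tendsto.mul h hr).div_const ((D : ℚ) + 1)).congr'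
      (key.mono fun n hn => hn.symm)
    refine PoleLike.congr (f := f) h1 (by field_simp)
  · intro h
    have h1 := ((Filter.Tendsto.div h hr one_ne_zero).mul_const ((D : ℚ) + 1))
    refine PoleLike.congr (f := eulerOp f) (h1.congr' ?_) (by field_simp)
    filter_upwards [key, Filter.eventually_ge_atTop 1] with n hn h1
    have hn' : (n : ℚ) ≠ 0 := by positivity
    have h0 := poleCoeff_pos (D + 1) n
    simp only [Pi.div_apply]
    rw [hn]
    have : (D : ℚ) + 1 + n ≠ 0 := by positivity
    field_simp

theorem expandSeries {D d : ℕ} {a : ℚ} {f : PowerSeries ℚ} (hf : PoleLike (D + 1) a f) :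
    PoleLike (D + 2) 0 (expandSeries d f) := by
  obtain ⟨K, hK0, hK⟩ := hf.exists_bound
  refine of_bound (K := K) fun n => ?_
  have h0 := poleCoeff_pos D n
  rw [_root_.expandSeries, PowerSeries.coeff_mk]
  split_ifs with h
  · exact (hK _).trans (mul_le_mul_of_nonneg_left (poleCoeff_mono D (Nat.div_le_self n d)) hK0)
  · rw [abs_zero]; positivity

end PoleLike

/-- The Abel polynomial `x (x + n) ^ (n - 1) / n!`. -/
noncomputable def abelPoly : ℕ → ℚ[X]
  | 0 => 1
  | n + 1 => C (((n + 1).factorial : ℚ)⁻¹) * (X * (X + C ((n : ℚ) + 1)) ^ n)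

theorem derivative_abelPoly_succ (n : ℕ) :
    derivative (abelPoly (n + 1)) = (abelPoly n).comp (X + 1) := by
  rcases n with _ | n
  · simp [abelPoly]
  · have hf : ((n + 2).factorial : ℚ)⁻¹ * (n + 2) = ((n + 1).factorial : ℚ)⁻¹ := by
      rw [Nat.factorial_succ (n + 1)]; push_cast; field_simp; ring
    simp only [abelPoly]
    rw [← hf]
    simp only [derivative_mul, derivative_C, derivative_X, derivative_pow, derivative_natCast,
      derivative_one, one_comp, natCast_comp, ofNat_comp, mul_comp, C_comp, X_comp, pow_comp, add_comp,
      add_tsub_cancel_right, map_mul, map_add,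
      map_natCast, map_one, map_ofNat, Nat.cast_add, Nat.cast_one]
    ring

theorem abelPoly_comp_add (y : ℚ) (n : ℕ) :
    (abelPoly n).comp (X + C y) =
      ∑ x ∈ antidiagonal n, abelPoly x.1 * C ((abelPoly x.2).eval y) := by
  induction n with
  | zero => simp [abelPoly]
  | succ n ih =>
    rw [← sub_eq_zero]
    set F := (abelPoly (n + 1)).comp (X + C y) -
      ∑ x ∈ antidiagonal (n + 1), abelPoly x.1 * C ((abelPoly x.2).eval y) with hF
    have hd : derivative F = 0 := by
      have h1 : ((abelPoly n).comp (X + 1)).comp (X + C y) =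
          ((abelPoly n).comp (X + C y)).comp (X + 1) := by
        rw [comp_assoc, comp_assoc]
        congr 1
        simp
        ring
      rw [hF, Finset.Nat.sum_antidiagonal_succ]
      simp only [derivative_sub, derivative_add, derivative_sum, derivative_comp,
        derivative_mul, derivative_abelPoly_succ, h1, ih, derivative_C]
      simp [abelPoly, Polynomial.sum_comp]
    have h0 : F.eval 0 = 0 := by
      rw [hF, Finset.Nat.sum_antidiagonal_succ]
      simp [abelPoly, eval_finsetSum]
    obtain ⟨c, hc⟩ := natDegree_eq_zero.1 (derivative_eq_zero.1 hd)
    rw [← hc] at h0 ⊢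
    rw [eval_C] at h0
    rw [h0, C_0]

theorem ck_eq_eval_abelPoly (n : ℕ) : ck n = (abelPoly n).eval 1 := by
  rcases n with _ | n
  · simp [ck, abelPoly]
  · simp only [ck, abelPoly, Nat.cast_add, Nat.cast_one, add_sub_cancel_right, zpow_natCast]
    simp
    ring

theorem sum_antidiagonal_ck_mul_ck (n : ℕ) :
    ((n : ℚ) + 2) * ∑ x ∈ antidiagonal n, ck x.1 * ck x.2 = 2 * ((n : ℚ) + 1) * ck (n + 1) := by
  have h := congrArg (eval 1) (abelPoly_comp_add 1 n)
  simp only [eval_finsetSum, eval_mul, eval_C, ← ck_eq_eval_abelPoly] at h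
  rw [← h]
  rcases n with _ | n
  · simp [ck, abelPoly]
  · rw [ck_eq_eval_abelPoly, abelPoly, abelPoly, Nat.factorial_succ (n + 1)]
    simp
    field_simp
    ring

theorem sum_antidiagonal_succ_mul_ck_mul_ck (n : ℕ) :
    ∑ x ∈ antidiagonal n, ((x.1 : ℚ) + 1) * ck x.1 * ck x.2 = ((n : ℚ) + 1) * ck (n + 1) := by
  have h1 := sum_antidiagonal_ck_mul_ck n
  have h2 : ∑ x ∈ antidiagonal n, ((x.1 : ℚ) + 1) * ck x.1 * ck x.2 =
      ∑ x ∈ antidiagonal n, ((x.2 : ℚ) + 1) * ck x.1 * ck x.2 := by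
    rw [← Finset.Nat.sum_antidiagonal_swap]
    exact Finset.sum_congr rfl fun x _ => by simp only [Prod.fst_swap, Prod.snd_swap]; ring
  have h3 : ∑ x ∈ antidiagonal n, ((x.1 : ℚ) + 1) * ck x.1 * ck x.2 +
      ∑ x ∈ antidiagonal n, ((x.2 : ℚ) + 1) * ck x.1 * ck x.2 =
      ((n : ℚ) + 2) * ∑ x ∈ antidiagonal n, ck x.1 * ck x.2 := by
    rw [← Finset.sum_add_distrib, Finset.mul_sum]
    refine Finset.sum_congr rfl fun x hx => ?_
    rw [← mem_antidiagonal.1 hx]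
    push_cast; ring
  linarith

theorem ck_sub_half_sum (n : ℕ) :
    ck (n + 1) - 2⁻¹ * ∑ x ∈ antidiagonal n, ck x.1 * ck x.2 = dk (n + 1) := by
  have h1 := sum_antidiagonal_ck_mul_ck n
  have h2 : dk (n + 1) * ((n : ℚ) + 2) = ck (n + 1) := by
    have : ((n : ℚ) + 1 + 1) ≠ 0 := by positivity
    rw [dk, ck]
    push_cast
    rw [show ((n : ℤ) + 1 - 1) = ((n : ℤ) + 1 - 2) + 1 by ring, zpow_add_one₀ this]
    ring
  have h3 : ((n : ℚ) + 2) ≠ 0 := by positivity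
  refine mul_right_cancel₀ h3 ?_
  linarith

/-- Specialization `m ↦ m₀`, as a ring homomorphism `ℚ[m][t] → ℚ[t]`. -/
noncomputable def evalM (m₀ : ℕ) : Qmt →+* ℚ[X] :=
  Polynomial.mapRingHom (Polynomial.evalRingHom (m₀ : ℚ))

theorem coeff_evalM (m₀ k : ℕ) (f : Qmt) : (evalM m₀ f).coeff k = (f.coeff k).eval (m₀ : ℚ) := by
  simp [evalM]

theorem coeff_evalM_tPow (m₀ k : ℕ) {d : ℕ} (hd : 0 < d) (f : Qmt) :
    (evalM m₀ (tPow d f)).coeff k = if d ∣ k then (evalM m₀ f).coeff (k / d) else 0 := by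
  have : evalM m₀ (tPow d f) = expand ℚ d (evalM m₀ f) := by
    simp [evalM, tPow, expand_eq_comp_X_pow, Polynomial.map_comp]
  rw [this, coeff_expand hd]

/-- The generating series of the coefficients of `t ^ k` of the `F n` at `m = m₀`. -/
noncomputable def slice (m₀ : ℕ) (F : ℕ → Qmt) (k : ℕ) : PowerSeries ℚ :=
  PowerSeries.mk fun n => (evalM m₀ (F n)).coeff k

theorem coeff_slice (m₀ : ℕ) (F : ℕ → Qmt) (k n : ℕ) :
    PowerSeries.coeff n (slice m₀ F k) = (evalM m₀ (F n)).coeff k :=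
  PowerSeries.coeff_mk _ _

theorem slice_eq_sum_antidiagonal (m₀ : ℕ) {F A B : ℕ → Qmt}
    (h : ∀ n, F n = ∑ x ∈ antidiagonal n, A x.1 * B x.2) (k : ℕ) :
    slice m₀ F k = ∑ y ∈ antidiagonal k, slice m₀ A y.1 * slice m₀ B y.2 := by
  ext n
  simp only [coeff_slice, map_sum, PowerSeries.coeff_mul, h, map_mul, finsetSum_coeff,
    Polynomial.coeff_mul]
  exact Finset.sum_comm

theorem eulerOp_slice (m₀ : ℕ) (F : ℕ → Qmt) (k : ℕ) :
    eulerOp (slice m₀ F k) = slice m₀ (fun n => (n : Qmt) * F n) k := by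
  ext n
  rw [coeff_eulerOp, coeff_slice, coeff_slice, map_mul, map_natCast, ← C_eq_natCast, coeff_C_mul]

theorem sum_Icc_sum_Icc_mul_le {R : Type*} [CommRing R] (u : ℕ → ℕ → R) (v : ℕ → R) (n : ℕ) :
    ∑ p ∈ Finset.Icc 1 n, ∑ d ∈ Finset.Icc 1 n,
        (if p * d ≤ n then u p d * v (n - p * d) else 0) =
      ∑ x ∈ antidiagonal n, (∑ y ∈ x.1.divisorsAntidiagonal, u y.1 y.2) * v x.2 := by
  have h : ∀ x ∈ antidiagonal n, (∑ y ∈ x.1.divisorsAntidiagonal, u y.1 y.2) * v x.2 =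
      ∑ y ∈ Finset.Icc 1 n ×ˢ Finset.Icc 1 n,
        if y.1 * y.2 = x.1 then u y.1 y.2 * v x.2 else 0 := by
    intro x hx
    have hx' := mem_antidiagonal.1 hx
    rw [Finset.sum_mul, ← Finset.sum_filter]
    refine Finset.sum_congr ?_ fun _ _ => rfl
    ext ⟨a, b⟩
    simp only [Nat.mem_divisorsAntidiagonal, Finset.mem_filter, Finset.mem_product,
      Finset.mem_Icc]
    constructor
    · rintro ⟨hab, h0⟩
      have ha : a ≠ 0 := by rintro rfl; simp at hab; omega
      have hb : b ≠ 0 := by rintro rfl; simp at hab; omega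
      have := Nat.le_mul_of_pos_right a (Nat.pos_of_ne_zero hb)
      have := Nat.le_mul_of_pos_left b (Nat.pos_of_ne_zero ha)
      omega
    · rintro ⟨⟨ha, hb⟩, hab⟩
      have := Nat.mul_le_mul ha.1 hb.1
      omega
  symm
  rw [Finset.sum_congr rfl h, Finset.sum_comm, Finset.sum_product]
  refine Finset.sum_congr rfl fun p _ => Finset.sum_congr rfl fun d _ => ?_
  rw [Finset.Nat.sum_antidiagonal_eq_sum_range_succ_mk, Finset.sum_ite_eq]
  simp only [Finset.mem_range, Nat.lt_succ_iff]

/-- The power-sum type terms `Σ_{pd = n} p (𝒬_p⁺)^{[d]}` in the recursion for `𝒬ₙ`. -/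
noncomputable def powerQ (n : ℕ) : Qmt :=
  ∑ y ∈ n.divisorsAntidiagonal, (y.1 : Qmt) * tPow y.2 (Qplus y.1)

theorem eulerOp_slice_Qweighted_one (m₀ k : ℕ) :
    eulerOp (slice m₀ (Qweighted fun _ => 1) k) =
      ∑ y ∈ antidiagonal k, slice m₀ powerQ y.1 * slice m₀ (Qweighted fun _ => 1) y.2 := by
  rw [eulerOp_slice]
  refine slice_eq_sum_antidiagonal m₀ (fun n => ?_) k
  rw [natCast_mul_Qweighted]
  exact sum_Icc_sum_Icc_mul_le (fun p d => (p : Qmt) * tPow d (Qplus p)) _ n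

theorem Qweighted_zero (w : ℕ → Qmt) : Qweighted w 0 = w 0 := by
  simp [Qweighted, countProd]

theorem coeff_zero_evalM_Qplus (m₀ p : ℕ) :
    (evalM m₀ (Qplus p)).coeff 0 = if p = 1 then (m₀ : ℚ) else 0 := by
  rw [coeff_evalM]
  split_ifs with h
  · rw [h, Qplus_one]; simp [mPoly]
  · rw [Qplus_eq_s1 h]
    simp only [Qweighted, finsetSum_coeff, mul_coeff_zero]
    rw [Finset.sum_eq_zero, eval_zero]
    intro lam _
    rw [Finset.sum_eq_zero, zero_mul]
    intro i hi
    rw [Finset.mem_Icc] at hi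
    simp [coeff_X_pow]
    omega

theorem coeff_slice_powerQ (m₀ k n : ℕ) :
    PowerSeries.coeff n (slice m₀ powerQ k) =
      ∑ d ∈ n.divisors, if d ∣ k then
        ((n / d : ℕ) : ℚ) * (evalM m₀ (Qplus (n / d))).coeff (k / d) else 0 := by
  rw [coeff_slice, powerQ, map_sum, finsetSum_coeff, ← Nat.sum_divisorsAntidiagonal'
    (f := fun p d => if d ∣ k then (p : ℚ) * (evalM m₀ (Qplus p)).coeff (k / d) else 0)]
  refine Finset.sum_congr rfl fun y hy => ?_
  have hy2 : 0 < y.2 := Nat.pos_of_ne_zero fun h => by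
    have := Nat.mem_divisorsAntidiagonal.1 hy
    rw [h] at this; omega
  rw [map_mul, map_natCast, ← C_eq_natCast, coeff_C_mul, coeff_evalM_tPow m₀ k hy2]
  split_ifs <;> simp

theorem slice_powerQ_zero (m₀ : ℕ) :
    (1 - PowerSeries.X) * slice m₀ powerQ 0 = PowerSeries.C (m₀ : ℚ) * PowerSeries.X := by
  have h : ∀ n, PowerSeries.coeff n (slice m₀ powerQ 0) = if n = 0 then 0 else (m₀ : ℚ) := by
    intro n
    rw [coeff_slice_powerQ]
    split_ifs with h
    · simp [h]
    · rw [Finset.sum_eq_single n]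
      · simp [Nat.div_self (Nat.pos_of_ne_zero h), coeff_zero_evalM_Qplus]
      · intro d hd hdn
        have hd' := Nat.mem_divisors.1 hd
        rw [if_pos (dvd_zero d), Nat.zero_div, coeff_zero_evalM_Qplus, if_neg, mul_zero]
        intro h1
        have := Nat.div_mul_cancel hd'.1
        rw [h1, one_mul] at this
        exact hdn this
      · simp [h]
  ext n
  rw [sub_mul, one_mul, map_sub]
  rcases n with _ | n
  · simp [h]
  · rw [PowerSeries.coeff_succ_X_mul, h, h, PowerSeries.coeff_C_mul, PowerSeries.coeff_X]
    rcases n with _ | n <;> simp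

theorem slice_powerQ_of_pos (m₀ : ℕ) {k : ℕ} (hk : 0 < k) :
    slice m₀ powerQ k = ∑ d ∈ k.divisors, expandSeries d (eulerOp (slice m₀ Qplus (k / d))) := by
  ext n
  rw [coeff_slice_powerQ, map_sum]
  simp only [expandSeries, PowerSeries.coeff_mk, coeff_eulerOp, coeff_slice]
  rcases Nat.eq_zero_or_pos n with rfl | hn
  · simp
  · rw [← Finset.sum_filter, ← Finset.sum_filter]
    refine Finset.sum_congr ?_ fun _ _ => rfl
    ext d
    simp only [Finset.mem_filter, Nat.mem_divisors]
    have := hn.ne'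
    have := hk.ne'
    tauto

/-- The elements of `ℚ[m][t]` whose specialization at `m = m₀` has nonnegative coefficients. -/
def nonnegAt (m₀ : ℕ) : Subsemiring Qmt where
  carrier := {f | ∀ k, 0 ≤ (evalM m₀ f).coeff k}
  mul_mem' {f g} hf hg k := by
    rw [map_mul, Polynomial.coeff_mul]
    exact Finset.sum_nonneg fun x _ => mul_nonneg (hf _) (hg _)
  one_mem' k := by
    rw [map_one, coeff_one]
    split_ifs <;> norm_num
  add_mem' {f g} hf hg k := by
    rw [map_add, coeff_add]
    exact add_nonneg (hf k) (hg k)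
  zero_mem' k := by simp

theorem plethH_mem_nonnegAt {m₀ r : ℕ} {f : Qmt} (hf : f ∈ nonnegAt m₀) :
    plethH r f ∈ nonnegAt m₀ := by
  refine sum_mem fun mu _ => mul_mem ?_ (multiset_prod_mem _ fun g hg => ?_)
  · intro k
    rw [coeff_evalM, coeff_C]
    split_ifs
    · rw [eval_C]; positivity
    · simp
  · obtain ⟨d, hd, rfl⟩ := Multiset.mem_map.1 hg
    intro k
    rw [coeff_evalM_tPow m₀ k (mu.parts_pos hd)]
    split_ifs
    exacts [hf _, le_rfl]

theorem Qplus_mem_nonnegAt (m₀ n : ℕ) : Qplus n ∈ nonnegAt m₀ := by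
  induction n using Nat.strong_induction_on with
  | _ n ih =>
    by_cases hn : n = 1
    · rw [hn, Qplus_one]
      intro k
      rw [coeff_evalM, mPoly, coeff_C]
      split_ifs <;> simp
    · rw [Qplus_eq_s1 hn]
      refine sum_mem fun lam _ => ?_
      by_cases h : n ∈ lam.parts
      · simp [lam.eq_indiscrete_of_mem h]
      · refine mul_mem (sum_mem fun i _ => pow_mem ?_ _) (prod_mem fun p hp => ?_)
        · intro k
          rw [coeff_evalM, coeff_X]
          split_ifs <;> simp
        · rw [Multiset.mem_toFinset] at hp
          exact plethH_mem_nonnegAt (ih p (lt_of_le_of_ne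
            (lam.parts_sum ▸ Multiset.le_sum_of_mem hp) fun e => h (e ▸ hp)))

theorem countProd_mem_nonnegAt (m₀ : ℕ) (s : Multiset ℕ) :
    countProd (fun p r => plethH r (Qplus p)) s ∈ nonnegAt m₀ :=
  prod_mem fun p _ => plethH_mem_nonnegAt (Qplus_mem_nonnegAt m₀ p)

theorem coeff_sum_X_pow_mul (f : ℚ[X]) (l k : ℕ) :
    ((∑ i ∈ Finset.Icc 1 l, X ^ i) * f).coeff (k + 1) =
      (if 1 ≤ l then f.coeff k else 0) +
        ∑ i ∈ Finset.Icc 2 (k + 1), if i ≤ l then f.coeff (k + 1 - i) else 0 := by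
  have h1 : Finset.Icc 1 (k + 1) = insert 1 (Finset.Icc 2 (k + 1)) := by
    ext i; simp only [Finset.mem_Icc, Finset.mem_insert]; omega
  rw [Finset.sum_mul, finsetSum_coeff]
  simp only [coeff_X_pow_mul']
  have h2 := Finset.sum_insert (f := fun i => if i ≤ l then f.coeff (k + 1 - i) else 0)
    (s := Finset.Icc 2 (k + 1)) (a := 1) (by simp)
  rw [← h1] at h2
  rw [show k + 1 - 1 = k by omega] at h2
  rw [← h2, ← Finset.sum_filter, ← Finset.sum_filter]
  refine Finset.sum_congr ?_ fun _ _ => rfl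
  ext i
  simp only [Finset.mem_filter, Finset.mem_Icc]
  omega

/-- Up to short partitions, `𝒬⁺_{n,k+1}` agrees with `𝒬_{n,k}` with an error bounded by the
coefficients of `𝒬ₙ` of lower order. -/
theorem coeff_slice_Qplus_bounds (m₀ k : ℕ) {n : ℕ} (hn : n ≠ 1) :
    0 ≤ PowerSeries.coeff n (slice m₀ Qplus (k + 1) - slice m₀ (Qweighted fun _ => 1) k +
        slice m₀ (Qweighted fun l => if l ≤ 2 then 1 else 0) k) ∧
      PowerSeries.coeff n (slice m₀ Qplus (k + 1) - slice m₀ (Qweighted fun _ => 1) k +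
        slice m₀ (Qweighted fun l => if l ≤ 2 then 1 else 0) k) ≤
      PowerSeries.coeff n (∑ i ∈ Finset.Icc 2 (k + 1),
        slice m₀ (Qweighted fun _ => 1) (k + 1 - i)) := by
  set g : n.Partition → ℚ[X] := fun lam =>
    evalM m₀ (countProd (fun p r => plethH r (Qplus p)) lam.parts) with hg
  have hg0 : ∀ lam k, 0 ≤ (g lam).coeff k := fun lam => countProd_mem_nonnegAt m₀ lam.parts
  have hX : evalM m₀ X = X := by simp [evalM]
  have h1 : ∀ j, PowerSeries.coeff n (slice m₀ (Qweighted fun _ => 1) j) =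
      ∑ lam : n.Partition, (g lam).coeff j := fun j => by
    simp [coeff_slice, Qweighted, hg, finsetSum_coeff]
  have h2 : PowerSeries.coeff n (slice m₀ (Qweighted fun l => if l ≤ 2 then 1 else 0) k) =
      ∑ lam : n.Partition, if lam.parts.card ≤ 2 then (g lam).coeff k else 0 := by
    simp only [coeff_slice, Qweighted, hg, finsetSum_coeff, map_sum, map_mul]
    refine Finset.sum_congr rfl fun lam _ => ?_
    split_ifs <;> simp
  have h3 : PowerSeries.coeff n (slice m₀ Qplus (k + 1)) = ∑ lam : n.Partition,
      ((if 1 ≤ lam.parts.card - 2 then (g lam).coeff k else 0) + ∑ i ∈ Finset.Icc 2 (k + 1),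
        if i ≤ lam.parts.card - 2 then (g lam).coeff (k + 1 - i) else 0) := by
    rw [coeff_slice, Qplus_eq_s1 hn]
    simp only [Qweighted, map_sum, map_mul, map_pow, hX, finsetSum_coeff, coeff_sum_X_pow_mul, hg]
  have h4 : PowerSeries.coeff n (slice m₀ Qplus (k + 1) - slice m₀ (Qweighted fun _ => 1) k +
        slice m₀ (Qweighted fun l => if l ≤ 2 then 1 else 0) k) =
      ∑ lam : n.Partition, ∑ i ∈ Finset.Icc 2 (k + 1),
        if i ≤ lam.parts.card - 2 then (g lam).coeff (k + 1 - i) else 0 := by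
    rw [map_add, map_sub, h1, h2, h3, ← Finset.sum_sub_distrib, ← Finset.sum_add_distrib]
    refine Finset.sum_congr rfl fun lam _ => ?_
    split_ifs <;> first | omega | ring
  rw [h4]
  constructor
  · refine Finset.sum_nonneg fun lam _ => Finset.sum_nonneg fun i _ => ?_
    split_ifs
    exacts [hg0 _ _, le_rfl]
  · rw [map_sum, Finset.sum_comm]
    refine Finset.sum_le_sum fun i _ => ?_
    rw [h1]
    refine Finset.sum_le_sum fun lam _ => ?_
    split_ifs
    exacts [le_rfl, hg0 _ _]

theorem Qweighted_length_zero {n : ℕ} (hn : n ≠ 0) :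
    Qweighted (fun l => if l = 0 then 1 else 0) n = 0 := by
  refine Finset.sum_eq_zero fun lam _ => ?_
  have h : lam.parts.card ≠ 0 := fun h => hn (by
    rw [← lam.parts_sum, Multiset.card_eq_zero.1 h, Multiset.sum_zero])
  dsimp only
  rw [if_neg h, zero_mul]

theorem Qweighted_length_one (n : ℕ) :
    Qweighted (fun l => if l = 1 then 1 else 0) n = Qplus n := by
  rcases Nat.eq_zero_or_pos n with rfl | hn
  · rw [Qweighted_zero, Qplus_eq_s1 (by norm_num), Qweighted_zero]
    simp
  · have hp : (Nat.Partition.indiscrete n).parts = {n} := Nat.Partition.indiscrete_parts hn.ne'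
    rw [Qweighted, Finset.sum_eq_single (Nat.Partition.indiscrete n)]
    · simp [hp, countProd, plethH_one]
    · intro lam _ hlam
      rw [if_neg, zero_mul]
      intro h
      obtain ⟨a, ha⟩ := Multiset.card_eq_one.1 h
      refine hlam (Nat.Partition.ext ?_)
      have := lam.parts_sum
      rw [ha, Multiset.sum_singleton] at this
      rw [hp, ha, this]
    · simp

theorem Qweighted_length_add_eq_two {d : ℕ} (j : ℕ) (hd : 1 ≤ d) :
    Qweighted (fun l => if l + d = 2 then 1 else 0) j =
      (if d = 1 then Qplus j else 0) + if d = 2 then (if j = 0 then 1 else 0) else 0 := by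
  have h0 : Qweighted (fun l => if l = 0 then 1 else 0) j = if j = 0 then 1 else 0 := by
    split_ifs with hj
    · rw [hj, Qweighted_zero, if_pos rfl]
    · exact Qweighted_length_zero hj
  rcases (by omega : d = 1 ∨ d = 2 ∨ 3 ≤ d) with rfl | rfl | h3
  · simp [← Qweighted_length_one j]
  · simpa using h0
  · rw [if_neg (by omega), if_neg (by omega)]
    refine (Finset.sum_eq_zero fun lam _ => ?_).trans (add_zero _).symm
    dsimp only
    rw [if_neg (by omega), zero_mul]

theorem sum_divisorsAntidiagonal_ite_mul_tPow (c N : ℕ) :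
    ∑ y ∈ N.divisorsAntidiagonal, (if y.2 = c then (y.1 : Qmt) * tPow y.2 (Qplus y.1) else 0) =
      if c ∣ N then ((N / c : ℕ) : Qmt) * tPow c (Qplus (N / c)) else 0 := by
  rw [Nat.sum_divisorsAntidiagonal'
    (f := fun p d => if d = c then (p : Qmt) * tPow d (Qplus p) else 0), Finset.sum_ite_eq']
  rcases Nat.eq_zero_or_pos N with rfl | hN
  · simp
  · simp [Nat.mem_divisors, hN.ne']

theorem sum_Icc_sum_Icc_ite_eq_two {R : Type*} [CommRing R] (u : ℕ → ℕ → R) (v : ℕ → R) (n : ℕ) :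
    ∑ p ∈ Finset.Icc 1 n, ∑ d ∈ Finset.Icc 1 n, (if p * d ≤ n then u p d *
        ((if d = 1 then v (n - p * d) else 0) +
          if d = 2 then (if n - p * d = 0 then 1 else 0) else 0) else 0) =
      ∑ x ∈ antidiagonal n, (∑ y ∈ x.1.divisorsAntidiagonal, if y.2 = 1 then u y.1 y.2 else 0) *
        v x.2 + ∑ y ∈ n.divisorsAntidiagonal, if y.2 = 2 then u y.1 y.2 else 0 := by
  have h1 : ∀ p d : ℕ, (if p * d ≤ n then u p d * ((if d = 1 then v (n - p * d) else 0) +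
        if d = 2 then (if n - p * d = 0 then 1 else 0) else 0) else 0) =
      (if p * d ≤ n then (if d = 1 then u p d else 0) * v (n - p * d) else 0) +
      if p * d ≤ n then (if d = 2 then u p d else 0) * (if n - p * d = 0 then 1 else 0) else 0 := by
    intro p d
    by_cases hp : p * d ≤ n
    · simp only [if_pos hp]
      rw [mul_add]
      congr 1
      · by_cases h : d = 1 <;> simp [h]
      · by_cases h : d = 2 <;> simp [h]
    · simp only [if_neg hp, add_zero]
  simp only [h1, Finset.sum_add_distrib]
  rw [sum_Icc_sum_Icc_mul_le (fun p d => if d = 1 then u p d else 0),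
    sum_Icc_sum_Icc_mul_le (fun p d => if d = 2 then u p d else 0) fun j => if j = 0 then 1 else 0]
  congr 1
  rw [Finset.sum_eq_single (n, 0)]
  · simp
  · rintro ⟨a, b⟩ hx hne
    have hab := mem_antidiagonal.1 hx
    have hb : b ≠ 0 := by
      rintro rfl
      exact hne (by simpa using hab)
    simp [hb]
  · simp

theorem natCast_mul_Qweighted_length_two (n : ℕ) :
    (n : Qmt) * Qweighted (fun l => if l = 2 then 1 else 0) n =
      ∑ x ∈ antidiagonal n, ((x.1 : Qmt) * Qplus x.1) * Qplus x.2 +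
        if 2 ∣ n then ((n / 2 : ℕ) : Qmt) * tPow 2 (Qplus (n / 2)) else 0 := by
  have h1 : (n : Qmt) * Qweighted (fun l => if l = 2 then 1 else 0) n =
      ∑ p ∈ Finset.Icc 1 n, ∑ d ∈ Finset.Icc 1 n, (if p * d ≤ n then
        ((p : Qmt) * tPow d (Qplus p)) * ((if d = 1 then Qplus (n - p * d) else 0) +
          if d = 2 then (if n - p * d = 0 then 1 else 0) else 0) else 0) := by
    rw [natCast_mul_Qweighted]
    refine Finset.sum_congr rfl fun p _ => Finset.sum_congr rfl fun d hd => ?_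
    rw [Qweighted_length_add_eq_two _ (Finset.mem_Icc.1 hd).1]
  rw [h1, sum_Icc_sum_Icc_ite_eq_two (fun p d => (p : Qmt) * tPow d (Qplus p))]
  simp only [sum_divisorsAntidiagonal_ite_mul_tPow]
  have h2 : ∀ i : ℕ, (if 1 ∣ i then ((i / 1 : ℕ) : Qmt) * tPow 1 (Qplus (i / 1)) else 0) =
      (i : Qmt) * Qplus i := fun i => by
    rw [if_pos (one_dvd _), Nat.div_one, tPow, pow_one, comp_X]
  simp only [h2]

theorem slice_add (m₀ : ℕ) (F G : ℕ → Qmt) (k : ℕ) :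
    slice m₀ (fun n => F n + G n) k = slice m₀ F k + slice m₀ G k := by
  ext n
  simp only [coeff_slice, map_add, coeff_add]

theorem slice_tPow (m₀ : ℕ) (F : ℕ → Qmt) {d : ℕ} (hd : 0 < d) (k : ℕ) :
    slice m₀ (fun n => if d ∣ n then tPow d (F (n / d)) else 0) k =
      if d ∣ k then expandSeries d (slice m₀ F (k / d)) else 0 := by
  ext n
  rw [coeff_slice]
  by_cases hn : d ∣ n <;> by_cases hk : d ∣ k <;>
    simp [hn, hk, coeff_evalM_tPow m₀ k hd, expandSeries, coeff_slice]

theorem eulerOp_slice_length_two (m₀ k : ℕ) :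
    eulerOp (slice m₀ (Qweighted fun l => if l = 2 then 1 else 0) k) =
      ∑ y ∈ antidiagonal k, eulerOp (slice m₀ Qplus y.1) * slice m₀ Qplus y.2 +
        if 2 ∣ k then expandSeries 2 (eulerOp (slice m₀ Qplus (k / 2))) else 0 := by
  have ht : ∀ n : ℕ, ((n / 2 : ℕ) : Qmt) * tPow 2 (Qplus (n / 2)) =
      tPow 2 ((n / 2 : ℕ) * Qplus (n / 2)) := fun n => by
    simp [tPow, mul_comp]
  have h1 : (fun n : ℕ => (n : Qmt) * Qweighted (fun l => if l = 2 then 1 else 0) n) =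
      fun n : ℕ => ∑ x ∈ antidiagonal n, ((x.1 : Qmt) * Qplus x.1) * Qplus x.2 +
        if 2 ∣ n then tPow 2 ((n / 2 : ℕ) * Qplus (n / 2)) else 0 :=
    funext fun n => by rw [natCast_mul_Qweighted_length_two, ht]
  rw [eulerOp_slice, h1, slice_add, slice_tPow m₀ (fun n => (n : Qmt) * Qplus n) two_pos,
    slice_eq_sum_antidiagonal m₀ (A := fun n => (n : Qmt) * Qplus n) (B := Qplus) (fun n => rfl)]
  simp only [eulerOp_slice]

theorem Qweighted_length_le_two (n : ℕ) :
    Qweighted (fun l => if l ≤ 2 then 1 else 0) n =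
      Qweighted (fun l => if l = 0 then 1 else 0) n + Qplus n +
        Qweighted (fun l => if l = 2 then 1 else 0) n := by
  rw [← Qweighted_length_one, Qweighted, Qweighted, Qweighted, Qweighted,
    ← Finset.sum_add_distrib, ← Finset.sum_add_distrib]
  refine Finset.sum_congr rfl fun lam _ => ?_
  rw [← add_mul, ← add_mul]
  congr 1
  rcases (by omega : lam.parts.card = 0 ∨ lam.parts.card = 1 ∨ lam.parts.card = 2 ∨
    3 ≤ lam.parts.card) with h | h | h | h
  · simp [h]
  · simp [h]
  · simp [h]
  · rw [if_neg (by omega), if_neg (by omega), if_neg (by omega), if_neg (by omega)]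
    simp

namespace PoleLike

theorem of_eventually_eq_zero {D : ℕ} {f : PowerSeries ℚ} (hD : 1 ≤ D)
    (h : ∀ᶠ n in Filter.atTop, PowerSeries.coeff n f = 0) : PoleLike D 0 f :=
  (PoleLike.zero D).congr_coeff hD (h.mono fun n hn => by rw [hn, map_zero])

theorem euler {D : ℕ} {a : ℚ} {f : PowerSeries ℚ} (hD : 1 ≤ D) (h : PoleLike D a f) :
    PoleLike (D + 1) (D * a) (eulerOp f) := by
  obtain ⟨D, rfl⟩ := Nat.exists_eq_add_of_le' hD
  exact (eulerOp_iff.2 h).congr (by push_cast; ring)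

theorem of_euler {D : ℕ} {a : ℚ} {f : PowerSeries ℚ} (hD : 1 ≤ D)
    (h : PoleLike (D + 1) (D * a) (eulerOp f)) : PoleLike D a f := by
  obtain ⟨D, rfl⟩ := Nat.exists_eq_add_of_le' hD
  exact eulerOp_iff.1 (h.congr (by push_cast; ring))

theorem slice_Qplus_zero (m₀ : ℕ) : PoleLike 1 0 (slice m₀ Qplus 0) := by
  refine of_eventually_eq_zero le_rfl ?_
  filter_upwards [Filter.eventually_gt_atTop 1] with n hn
  rw [coeff_slice, coeff_zero_evalM_Qplus, if_neg hn.ne']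

theorem euler_slice_Qplus_zero (m₀ : ℕ) : PoleLike 1 0 (eulerOp (slice m₀ Qplus 0)) := by
  refine of_eventually_eq_zero le_rfl ?_
  filter_upwards [Filter.eventually_gt_atTop 1] with n hn
  rw [coeff_eulerOp, coeff_slice, coeff_zero_evalM_Qplus, if_neg hn.ne', mul_zero]

/-- The contribution of the partitions with at most two parts is of lower order. -/
theorem slice_length_le_two {m₀ k : ℕ} (hm : 1 ≤ m₀)
    (h : ∀ i, 1 ≤ i → i ≤ k → PoleLike (i * m₀) (ck (i - 1)) (slice m₀ Qplus i)) :
    PoleLike ((k + 1) * m₀) 0 (slice m₀ (Qweighted fun l => if l ≤ 2 then 1 else 0) k) := by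
  have hk : (k + 1) * m₀ = k * m₀ + m₀ := by ring
  have h0 : ∀ i ≤ k, PoleLike (i * m₀ + 1) 0 (slice m₀ Qplus i) := fun i hi => by
    rcases Nat.eq_zero_or_pos i with rfl | hpos
    · rw [zero_mul]; exact slice_Qplus_zero m₀
    · exact (h i hpos hi).succ
  have h1 : ∀ i ≤ k, ∃ a, PoleLike (i * m₀ + 1) a (eulerOp (slice m₀ Qplus i)) := fun i hi => by
    rcases Nat.eq_zero_or_pos i with rfl | hpos
    · rw [zero_mul]; exact ⟨0, euler_slice_Qplus_zero m₀⟩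
    · exact ⟨_, (h i hpos hi).euler (Nat.mul_pos hpos hm)⟩
  have h2 : PoleLike ((k + 1) * m₀) 0 (slice m₀ (Qweighted fun l => if l = 2 then 1 else 0) k) := by
    refine of_euler (Nat.mul_pos k.succ_pos hm) ?_
    rw [eulerOp_slice_length_two, mul_zero]
    have hs : PoleLike ((k + 1) * m₀ + 1) (∑ y ∈ antidiagonal k, 0)
        (∑ y ∈ antidiagonal k, eulerOp (slice m₀ Qplus y.1) * slice m₀ Qplus y.2) := by
      refine PoleLike.sum _ fun y hy => ?_
      have hy := mem_antidiagonal.1 hy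
      obtain ⟨a, ha⟩ := h1 y.1 (by omega)
      refine ((ha.mul (h0 y.2 (by omega))).congr (mul_zero a)).mono_zero ?_
      have : y.1 * m₀ + y.2 * m₀ = k * m₀ := by rw [← add_mul, hy]
      omega
    have he : PoleLike ((k + 1) * m₀ + 1) 0
        (if 2 ∣ k then _root_.expandSeries 2 (eulerOp (slice m₀ Qplus (k / 2))) else 0) := by
      split_ifs
      · obtain ⟨a, ha⟩ := h1 (k / 2) (Nat.div_le_self _ _)
        refine ha.expandSeries.mono_zero ?_
        have := Nat.mul_le_mul_right m₀ (Nat.div_le_self k 2)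
        omega
      · exact PoleLike.zero _
    exact (hs.add he).congr (by simp)
  have h3 : PoleLike ((k + 1) * m₀) 0
      (slice m₀ (Qweighted fun l => if l = 0 then 1 else 0) k) := by
    refine of_eventually_eq_zero (Nat.mul_pos k.succ_pos hm) ?_
    filter_upwards [Filter.eventually_gt_atTop 0] with n hn
    rw [coeff_slice, Qweighted_length_zero hn.ne', map_zero, coeff_zero]
  rw [funext Qweighted_length_le_two, slice_add, slice_add]
  exact ((h3.add ((h0 k le_rfl).mono_zero (by omega))).add h2).congr (by simp)

theorem slice_powerQ {m₀ k : ℕ} (hm : 1 ≤ m₀) (hk : 1 ≤ k)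
    (h : ∀ i, 1 ≤ i → i ≤ k → PoleLike (i * m₀) (ck (i - 1)) (slice m₀ Qplus i)) :
    PoleLike (k * m₀ + 1) (k * m₀ * ck (k - 1)) (slice m₀ powerQ k) := by
  rw [slice_powerQ_of_pos m₀ hk]
  have hs : PoleLike (k * m₀ + 1)
      (∑ d ∈ k.divisors, if d = 1 then (k * m₀ * ck (k - 1) : ℚ) else 0)
      (∑ d ∈ k.divisors, _root_.expandSeries d (eulerOp (slice m₀ Qplus (k / d)))) := by
    refine PoleLike.sum _ fun d hd => ?_
    have hdk := Nat.dvd_of_mem_divisors hd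
    have hd0 : 0 < d := Nat.pos_of_dvd_of_pos hdk hk
    have hkd : 1 ≤ k / d := Nat.div_pos (Nat.le_of_dvd hk hdk) hd0
    have he := (h (k / d) hkd (Nat.div_le_self k d)).euler (Nat.mul_pos hkd hm)
    split_ifs with h1
    · subst h1
      rw [Nat.div_one] at he ⊢
      have hexp : ∀ f : PowerSeries ℚ, _root_.expandSeries 1 f = f := fun f => by
        ext n; simp [_root_.expandSeries]
      rw [hexp]
      exact he.congr (by push_cast; ring)
    · refine he.expandSeries.mono_zero ?_
      have hlt : k / d + 1 ≤ k := Nat.div_lt_self hk (by omega)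
      have := Nat.mul_le_mul_right m₀ hlt
      rw [add_mul] at this
      omega
  exact hs.congr (by
    rw [Finset.sum_ite_eq', if_pos (Nat.one_mem_divisors.2 (by omega))])

end PoleLike

/-- The generating series of the `𝒬ₙ` (with constant term `1`), multiplied by `(1 - x) ^ m₀`. -/
noncomputable def reducedSlice (m₀ k : ℕ) : PowerSeries ℚ :=
  (1 - PowerSeries.X) ^ m₀ * slice m₀ (Qweighted fun _ => 1) k

theorem invOneSubPow_mul_reducedSlice (m₀ k : ℕ) :
    (PowerSeries.invOneSubPow ℚ m₀).val * reducedSlice m₀ k =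
      slice m₀ (Qweighted fun _ => 1) k := by
  rw [reducedSlice, ← mul_assoc, ← PowerSeries.invOneSubPow_inv_eq_one_sub_pow,
    (PowerSeries.invOneSubPow ℚ m₀).val_inv, one_mul]

theorem eulerOp_one_sub_X_pow (m₀ : ℕ) :
    eulerOp ((1 - PowerSeries.X) ^ m₀) + (1 - PowerSeries.X) ^ m₀ * slice m₀ powerQ 0 = 0 := by
  rcases m₀ with _ | m
  · have h := slice_powerQ_zero 0
    have hne : (1 - PowerSeries.X : PowerSeries ℚ) ≠ 0 := fun h => by
      simpa using congrArg (PowerSeries.coeff 0) h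
    rw [Nat.cast_zero, map_zero, zero_mul] at h
    rw [(mul_eq_zero.1 h).resolve_left hne]
    simp [eulerOp]
  · rw [pow_succ, mul_assoc, slice_powerQ_zero, ← pow_succ, eulerOp, Derivation.leibniz_pow,
      map_sub, Derivation.map_one_eq_zero, PowerSeries.derivative_X]
    simp [smul_eq_mul]
    ring

theorem eulerOp_reducedSlice_zero (m₀ : ℕ) : eulerOp (reducedSlice m₀ 0) = 0 := by
  rw [reducedSlice, eulerOp_mul, eulerOp_slice_Qweighted_one, Finset.Nat.antidiagonal_zero,
    Finset.sum_singleton, ← mul_assoc, ← add_mul, eulerOp_one_sub_X_pow, zero_mul]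

theorem eulerOp_reducedSlice_succ (m₀ k : ℕ) :
    eulerOp (reducedSlice m₀ (k + 1)) =
      ∑ y ∈ antidiagonal k, slice m₀ powerQ (y.1 + 1) * reducedSlice m₀ y.2 := by
  rw [reducedSlice, eulerOp_mul, eulerOp_slice_Qweighted_one, Finset.Nat.sum_antidiagonal_succ,
    mul_add, ← mul_assoc, ← add_assoc, ← add_mul, eulerOp_one_sub_X_pow, zero_mul, zero_add,
    Finset.mul_sum]
  exact Finset.sum_congr rfl fun y _ => by rw [reducedSlice]; ring

theorem reducedSlice_zero (m₀ : ℕ) : reducedSlice m₀ 0 = PowerSeries.C 1 := by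
  ext n
  rcases Nat.eq_zero_or_pos n with rfl | hn
  · rw [reducedSlice, PowerSeries.coeff_zero_eq_constantCoeff_apply, map_mul,
      ← PowerSeries.coeff_zero_eq_constantCoeff_apply (slice _ _ _), coeff_slice, Qweighted_zero]
    simp
  · have h := congrArg (PowerSeries.coeff n) (eulerOp_reducedSlice_zero m₀)
    rw [coeff_eulerOp, map_zero] at h
    rw [PowerSeries.coeff_C, if_neg hn.ne']
    exact (mul_eq_zero.1 h).resolve_left (by exact_mod_cast hn.ne')

namespace PoleLike

theorem slice_Qweighted_one {m₀ k : ℕ} {a : ℚ} (h : PoleLike (k * m₀) a (reducedSlice m₀ k)) :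
    PoleLike ((k + 1) * m₀) a (slice m₀ (Qweighted fun _ => 1) k) := by
  have := (PoleLike.invOneSubPow m₀).mul h
  rw [invOneSubPow_mul_reducedSlice, one_mul] at this
  rwa [add_mul, one_mul, add_comm]

theorem reducedSlice_and_slice_Qplus {m₀ : ℕ} (hm : 1 ≤ m₀) (k : ℕ) :
    PoleLike (k * m₀) (ck k) (reducedSlice m₀ k) ∧
      PoleLike ((k + 1) * m₀) (ck k) (slice m₀ Qplus (k + 1)) := by
  induction k using Nat.strong_induction_on with
  | _ k ih =>
    have hQ : ∀ i, 1 ≤ i → i ≤ k → PoleLike (i * m₀) (ck (i - 1)) (slice m₀ Qplus i) := by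
      intro i h1 hi
      obtain ⟨i, rfl⟩ := Nat.exists_eq_add_of_le' h1
      exact (ih i (by omega)).2
    have hG : PoleLike (k * m₀) (ck k) (reducedSlice m₀ k) := by
      rcases k with _ | k
      · rw [zero_mul, reducedSlice_zero]
        exact congrArg PowerSeries.C (by simp [ck])
      · refine of_euler (Nat.mul_pos k.succ_pos hm) ?_
        rw [eulerOp_reducedSlice_succ]
        have hs : PoleLike ((k + 1) * m₀ + 1)
            (∑ y ∈ antidiagonal k, (((y.1 + 1 : ℕ) : ℚ) * m₀ * ck (y.1 + 1 - 1)) * ck y.2)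
            (∑ y ∈ antidiagonal k, slice m₀ powerQ (y.1 + 1) * reducedSlice m₀ y.2) := by
          refine PoleLike.sum _ fun y hy => ?_
          have hy := mem_antidiagonal.1 hy
          have := (slice_powerQ hm (by omega : 1 ≤ y.1 + 1) fun i h1 hi =>
            hQ i h1 (by omega)).mul (ih y.2 (by omega)).1
          rwa [show (y.1 + 1) * m₀ + 1 + y.2 * m₀ = (k + 1) * m₀ + 1 by rw [← hy]; ring] at this
        refine hs.congr ?_
        have := sum_antidiagonal_succ_mul_ck_mul_ck k
        push_cast
        rw [show ((k : ℚ) + 1) * m₀ * ck (k + 1) = m₀ * (((k : ℚ) + 1) * ck (k + 1)) by ring,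
          ← this, Finset.mul_sum]
        exact Finset.sum_congr rfl fun y _ => by ring
    refine ⟨hG, ?_⟩
    have hpos : 1 ≤ (k + 1) * m₀ := Nat.mul_pos k.succ_pos hm
    have hT := hG.slice_Qweighted_one
    have hS := slice_length_le_two hm hQ
    have hle : PoleLike ((k + 1) * m₀) (∑ i ∈ Finset.Icc 2 (k + 1), 0)
        (∑ i ∈ Finset.Icc 2 (k + 1), slice m₀ (Qweighted fun _ => 1) (k + 1 - i)) := by
      refine PoleLike.sum _ fun i hi => ?_
      have hi := Finset.mem_Icc.1 hi
      refine (ih (k + 1 - i) (by omega)).1.slice_Qweighted_one.mono ?_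
      exact Nat.mul_lt_mul_of_pos_right (by omega) hm
    have hr := (hle.congr Finset.sum_const_zero).squeeze hpos (g := slice m₀ Qplus (k + 1) -
        slice m₀ (Qweighted fun _ => 1) k +
        slice m₀ (Qweighted fun l => if l ≤ 2 then 1 else 0) k) <| by
      filter_upwards [Filter.eventually_gt_atTop 1] with n hn
      exact coeff_slice_Qplus_bounds m₀ k hn.ne'
    have := (hT.sub hS).add hr
    rw [sub_zero, add_zero] at this
    convert this using 1
    ring

end PoleLike

/-- `𝒬ₙ` for `n ≥ 2`, and zero otherwise. -/
noncomputable def Qtrunc (n : ℕ) : Qmt := if n ≤ 1 then 0 else Qfull n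

/-- The right-hand side of the relation defining `𝒫ₙ`, as a full convolution. -/
noncomputable def PrhsConv (n : ℕ) : Qmt :=
  Qtrunc n - C (C (2 : ℚ)⁻¹) * X * (∑ x ∈ antidiagonal n, Qtrunc x.1 * Qtrunc x.2 -
    if 2 ∣ n then tPow 2 (Qtrunc (n / 2)) else 0)

theorem Prhs_eq_PrhsConv {n : ℕ} (hn : 3 ≤ n) : Prhs n = PrhsConv n := by
  have h1 : Qtrunc n = Qfull n := if_neg (by omega)
  have h2 : ∑ h ∈ Finset.Icc 2 (n - 2), Qfull h * Qfull (n - h) =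
      ∑ x ∈ antidiagonal n, Qtrunc x.1 * Qtrunc x.2 := by
    rw [Finset.Nat.sum_antidiagonal_eq_sum_range_succ_mk]
    have hsub : Finset.Icc 2 (n - 2) ⊆ Finset.range n.succ := fun h hh => by
      have := Finset.mem_Icc.1 hh
      exact Finset.mem_range.2 (by omega)
    rw [← Finset.sum_subset hsub]
    · refine Finset.sum_congr rfl fun h hh => ?_
      have := Finset.mem_Icc.1 hh
      dsimp only
      rw [Qtrunc, Qtrunc, if_neg (by omega), if_neg (by omega)]
    · intro h _ hh
      rw [Finset.mem_Icc] at hh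
      dsimp only
      rw [Qtrunc, Qtrunc]
      by_cases hle : h ≤ 1
      · rw [if_pos hle, zero_mul]
      · rw [if_pos (by omega : n - h ≤ 1), mul_zero]
  have h3 : (if 2 ∣ n then tPow 2 (Qfull (n / 2)) else 0) =
      if 2 ∣ n then tPow 2 (Qtrunc (n / 2)) else 0 := by
    split_ifs with h
    · rw [Qtrunc, if_neg (by omega)]
    · rfl
  rw [Prhs, PrhsConv, h1, h2, h3]

theorem slice_PrhsConv_zero (m₀ : ℕ) : slice m₀ PrhsConv 0 = slice m₀ Qtrunc 0 := by
  ext n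
  rw [coeff_slice, coeff_slice, PrhsConv, coeff_evalM, coeff_evalM, mul_assoc, coeff_sub,
    coeff_C_mul, coeff_X_mul_zero, mul_zero, sub_zero]

theorem slice_PrhsConv_succ (m₀ k : ℕ) :
    slice m₀ PrhsConv (k + 1) = slice m₀ Qtrunc (k + 1) - PowerSeries.C 2⁻¹ *
      (∑ y ∈ antidiagonal k, slice m₀ Qtrunc y.1 * slice m₀ Qtrunc y.2 -
        if 2 ∣ k then expandSeries 2 (slice m₀ Qtrunc (k / 2)) else 0) := by
  rw [← slice_tPow m₀ Qtrunc two_pos, ← slice_eq_sum_antidiagonal m₀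
    (F := fun n => ∑ x ∈ antidiagonal n, Qtrunc x.1 * Qtrunc x.2) (fun n => rfl)]
  ext n
  rw [map_sub, PowerSeries.coeff_C_mul, map_sub]
  simp only [coeff_slice, PrhsConv, coeff_evalM, mul_assoc, coeff_sub, coeff_C_mul, coeff_X_mul,
    eval_sub, eval_mul, eval_C]

theorem slice_add_slice_succ {m₀ k n : ℕ} {P : ℕ → Qmt} (h : (1 + X) * P n = PrhsConv n) :
    PowerSeries.coeff n (slice m₀ P (k + 1)) =
      PowerSeries.coeff n (slice m₀ PrhsConv (k + 1) - slice m₀ P k) := by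
  rw [map_sub, coeff_slice, coeff_slice, coeff_slice, ← h, coeff_evalM, coeff_evalM, coeff_evalM,
    add_mul, one_mul, coeff_add, coeff_X_mul, eval_add]
  ring

namespace PoleLike

theorem slice_Qtrunc {m₀ : ℕ} (hm : 1 ≤ m₀) (k : ℕ) :
    PoleLike ((k + 1) * m₀) (ck k) (slice m₀ Qtrunc k) := by
  refine (reducedSlice_and_slice_Qplus hm k).1.slice_Qweighted_one.congr_coeff
    (Nat.mul_pos k.succ_pos hm) ?_
  filter_upwards [Filter.eventually_gt_atTop 1] with n hn
  rw [coeff_slice, coeff_slice, Qtrunc, if_neg (by omega), Qfull_eq (by omega)]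

theorem slice_PrhsConv {m₀ : ℕ} (hm : 1 ≤ m₀) (k : ℕ) :
    PoleLike ((k + 1) * m₀) (dk k) (slice m₀ PrhsConv k) := by
  rcases k with _ | k
  · rw [slice_PrhsConv_zero]
    exact (slice_Qtrunc hm 0).congr (by simp [ck, dk])
  · have hs : PoleLike ((k + 1 + 1) * m₀) (∑ y ∈ antidiagonal k, ck y.1 * ck y.2)
        (∑ y ∈ antidiagonal k, slice m₀ Qtrunc y.1 * slice m₀ Qtrunc y.2) := by
      refine PoleLike.sum _ fun y hy => ?_
      have := (slice_Qtrunc hm y.1).mul (slice_Qtrunc hm y.2)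
      rwa [← add_mul, show y.1 + 1 + (y.2 + 1) = k + 1 + 1 by
        rw [← mem_antidiagonal.1 hy]; ring] at this
    have he : PoleLike ((k + 1 + 1) * m₀) 0
        (if 2 ∣ k then _root_.expandSeries 2 (slice m₀ Qtrunc (k / 2)) else 0) := by
      split_ifs
      · have h := slice_Qtrunc hm (k / 2)
        have hle := Nat.mul_le_mul_right m₀ (by omega : k / 2 + 1 + 1 ≤ k + 1 + 1)
        rw [add_mul (k / 2 + 1), one_mul] at hle
        obtain ⟨D, hD⟩ := Nat.exists_eq_add_of_le' (Nat.mul_pos (k / 2).succ_pos hm)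
        rw [Nat.succ_eq_add_one] at hD
        rw [hD] at h hle
        exact h.expandSeries.mono_zero (by omega)
      · exact PoleLike.zero _
    rw [slice_PrhsConv_succ]
    exact ((slice_Qtrunc hm (k + 1)).sub ((hs.sub he).C_mul 2⁻¹)).congr
      (by rw [sub_zero, ck_sub_half_sum])

theorem slice_P {m₀ : ℕ} (hm : 1 ≤ m₀) {P : ℕ → Qmt}
    (hP : ∀ n : ℕ, 3 ≤ n → (1 + X) * P n = Prhs n) (k : ℕ) :
    PoleLike ((k + 1) * m₀) (dk k) (slice m₀ P k) := by
  induction k with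
  | zero =>
    refine (slice_PrhsConv hm 0).congr_coeff (Nat.mul_pos one_pos hm) ?_
    filter_upwards [Filter.eventually_ge_atTop 3] with n hn
    rw [coeff_slice, coeff_slice, ← Prhs_eq_PrhsConv hn, ← hP n hn, coeff_evalM, coeff_evalM,
      mul_coeff_zero]
    simp
  | succ k ih =>
    have hlt : (k + 1) * m₀ < (k + 1 + 1) * m₀ := Nat.mul_lt_mul_of_pos_right (by omega) hm
    refine (((slice_PrhsConv hm (k + 1)).sub (ih.mono hlt)).congr (sub_zero _)).congr_coeff
      (Nat.mul_pos (k + 1).succ_pos hm) ?_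
    filter_upwards [Filter.eventually_ge_atTop 3] with n hn
    exact (slice_add_slice_succ ((hP n hn).trans (Prhs_eq_PrhsConv hn))).symm

end PoleLike

theorem tendsto_poleCoeff_div_pow (D : ℕ) :
    Filter.Tendsto (fun n : ℕ => poleCoeff D n / (n : ℚ) ^ D) Filter.atTop
      (nhds (1 / (D.factorial : ℚ))) := by
  induction D with
  | zero => simp [poleCoeff]
  | succ D ih =>
    have h1 : Filter.Tendsto (fun n : ℕ => (D + 1 : ℚ) / (n : ℚ)) Filter.atTop (nhds 0) :=
      tendsto_const_nhds.div_atTop tendsto_natCast_atTop_atTop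
    have h2 := (ih.mul (h1.add_const 1)).div_const (D + 1 : ℚ)
    have hD : (D + 1 : ℚ) ≠ 0 := by positivity
    refine (h2.congr' ?_).trans_eq ?_
    · filter_upwards [Filter.eventually_gt_atTop 0] with n hn
      have hn' : (n : ℚ) ≠ 0 := by exact_mod_cast hn.ne'
      rw [eq_div_of_mul_eq hD (poleCoeff_succ D n)]
      field_simp
      ring
    · rw [Nat.factorial_succ]
      push_cast
      field_simp
      simp

/-- Let `𝒫ₙ` (for `n ≥ 3`) be the unique polynomials satisfying
`(1+t)·𝒫ₙ = 𝒬ₙ − (t/2)(Σ_{h=2}^{n-2} 𝒬_h 𝒬_{n-h} − 𝒬_{n/2}^{[2]})`.  For fixed `m₀ ≥ 1` and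
`k ≥ 0`, as `n → ∞`,
`𝒫_{n,k}(m₀) = (d_k/((k+1)m₀−1)!)·n^{(k+1)m₀−1} + o(n^{(k+1)m₀−1})`. -/
theorem Pnk_value_asymptotic (m₀ k : ℕ) (hm : 1 ≤ m₀)
    (P : ℕ → Qmt) (hP : ∀ n : ℕ, 3 ≤ n → (1 + Polynomial.X) * P n = Prhs n) :
    Filter.Tendsto
      (fun n : ℕ =>
        (((P n).coeff k).eval (m₀ : ℚ) -
            dk k / (((k + 1) * m₀ - 1).factorial : ℚ) * (n : ℚ) ^ ((k + 1) * m₀ - 1)) /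
          (n : ℚ) ^ ((k + 1) * m₀ - 1))
      Filter.atTop (nhds 0) := by
  have hpos : 1 ≤ (k + 1) * m₀ := Nat.mul_pos k.succ_pos hm
  have h := PoleLike.slice_P hm hP k
  obtain ⟨D, hD⟩ := Nat.exists_eq_add_of_le' hpos
  rw [hD] at h ⊢
  rw [Nat.add_sub_cancel]
  have h1 : Filter.Tendsto (fun n => PowerSeries.coeff n (slice m₀ P k) / poleCoeff D n)
    Filter.atTop (nhds (dk k)) := h
  have h2 := (h1.mul (tendsto_poleCoeff_div_pow D)).sub_const (dk k / (D.factorial : ℚ))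
  rw [mul_one_div, sub_self] at h2
  refine h2.congr' ?_
  filter_upwards [Filter.eventually_gt_atTop 0] with n hn
  have hn' : (n : ℚ) ^ D ≠ 0 := pow_ne_zero _ (by exact_mod_cast hn.ne')
  rw [coeff_slice, coeff_evalM, div_mul_div_cancel₀ (poleCoeff_pos D n).ne', sub_div,
    mul_div_cancel_right₀ _ hn']
end
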